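/- For every ε > 0 there exists τ₂ > 0 such that for every τ ∈ (0, τ₂], one has #PowerPairs(τ) ≤ τ^{−δ−ε}, where δ is the Hausdorff dimension of the limit set Λ. -/

import Mathlib

open MeasureTheory

/-- `SL(2,ℝ)`. -/
abbrev SL2 : Type := Matrix.SpecialLinearGroup (Fin 2) ℝ

/-- The Möbius transformation of `g ∈ SL(2,ℝ)` acting on `ℂ` (junk at the pole). -/
noncomputable def mobiusC (g : SL2) (z : ℂ) : ℂ :=
  ((g.1 0 0 : ℂ) * z + (g.1 0 1 : ℂ)) / ((g.1 1 0 : ℂ) * z + (g.1 1 1 : ℂ))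

/-- The Möbius transformation of `g ∈ SL(2,ℝ)` acting on `ℝ` (junk at the pole). -/
noncomputable def mobiusR (g : SL2) (x : ℝ) : ℝ :=
  (g.1 0 0 * x + g.1 0 1) / (g.1 1 0 * x + g.1 1 1)

/-- The derivative `γ'(z) = (uz+v)⁻²` of the Möbius transformation of `g`. -/
noncomputable def mobiusDerivC (g : SL2) (z : ℂ) : ℂ :=
  ((g.1 1 0 : ℂ) * z + (g.1 1 1 : ℂ))⁻¹ ^ 2

/-- The derivative `γ'(x) = (ux+v)⁻²` of the Möbius transformation of `g`, real version. -/
noncomputable def mobiusDerivR (g : SL2) (x : ℝ) : ℝ :=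
  (g.1 1 0 * x + g.1 1 1)⁻¹ ^ 2

/-- The Möbius transformation of `g ∈ SL(2,ℝ)` acting on the Riemann sphere `ℂ ∪ {∞}`. -/
noncomputable def mobiusS (g : SL2) (z : OnePoint ℂ) : OnePoint ℂ :=
  Option.elim z
    (if (g.1 1 0 : ℝ) = 0 then OnePoint.infty else (((g.1 0 0 / g.1 1 0 : ℝ) : ℂ) : OnePoint ℂ))
    (fun w => if ((g.1 1 0 : ℂ) * w + (g.1 1 1 : ℂ)) = 0 then OnePoint.infty
      else ((mobiusC g w : ℂ) : OnePoint ℂ))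

/-- The involution `a ↦ ā = a + r mod 2r` on the alphabet `𝒜 = Fin (2r)`. -/
def wordBar {r : ℕ} (a : Fin (2 * r)) : Fin (2 * r) :=
  ⟨(a.1 + r) % (2 * r), Nat.mod_lt _ (Nat.lt_of_le_of_lt (Nat.zero_le _) a.isLt)⟩

/-- A word: a finite sequence of letters with no adjacent letter equal to the bar of the
previous one. -/
def IsWord {r : ℕ} (w : List (Fin (2 * r))) : Prop :=
  w.Chain' (fun x y => x ≠ wordBar y)

/-- The mirror word `𝐚̄ = (ā_n, …, ā_1)`. -/
def mirror {r : ℕ} (w : List (Fin (2 * r))) : List (Fin (2 * r)) :=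
  (w.map wordBar).reverse

/-- `𝐚 → 𝐛` : either word is empty, or the last letter of `𝐚` is not the bar of the first
letter of `𝐛`. -/
def arrow {r : ℕ} (w v : List (Fin (2 * r))) : Prop :=
  ∀ x ∈ w.getLast?, ∀ y ∈ v.head?, x ≠ wordBar y

/-- `𝐚 ⇝ 𝐛` : both words are nonempty and the last letter of `𝐚` equals the first letter
of `𝐛`. -/
def wiggly {r : ℕ} (w v : List (Fin (2 * r))) : Prop :=
  w ≠ [] ∧ v ≠ [] ∧ w.getLast? = v.head?

/-- Schottky data: pairwise disjoint closed discs centered on the real line, paired by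
elements of `SL(2,ℝ)`. -/
structure Schottky where
  r : ℕ
  two_le_r : 2 ≤ r
  center : Fin (2 * r) → ℝ
  radius : Fin (2 * r) → ℝ
  radius_pos : ∀ a, 0 < radius a
  g : Fin (2 * r) → SL2
  disjoint : ∀ a b : Fin (2 * r), a ≠ b →
    Disjoint (closure (Metric.ball ((center a : ℂ)) (radius a)))
             (closure (Metric.ball ((center b : ℂ)) (radius b)))
  g_bar : ∀ a : Fin (2 * r), g (wordBar a) = (g a)⁻¹
  maps : ∀ a : Fin (2 * r),
    mobiusS (g a) '' (((fun w : ℂ => (w : OnePoint ℂ)) ''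
        Metric.ball ((center (wordBar a) : ℂ)) (radius (wordBar a)))ᶜ)
      = (fun w : ℂ => (w : OnePoint ℂ)) '' closure (Metric.ball ((center a : ℂ)) (radius a))

namespace Schottky

variable (S : Schottky)

/-- The open disc `D_a`. -/
def D (a : Fin (2 * S.r)) : Set ℂ := Metric.ball ((S.center a : ℂ)) (S.radius a)

/-- The union `𝐃` of the open discs. -/
def Dall : Set ℂ := ⋃ a, S.D a

/-- The open interval `I_a = D_a ∩ ℝ`. -/
def Ireal (a : Fin (2 * S.r)) : Set ℝ := {x : ℝ | (x : ℂ) ∈ S.D a}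

/-- The union `I` of the intervals `I_a`. -/
def Iall : Set ℝ := ⋃ a, S.Ireal a

/-- The group element `γ_𝐚 = γ_{a₁} ⋯ γ_{a_n}` associated to a word. -/
noncomputable def wprod (w : List (Fin (2 * S.r))) : SL2 := (w.map S.g).prod

/-- The Schottky group `Γ`, generated by the `γ_a`. -/
def SGroup : Subgroup SL2 := Subgroup.closure (Set.range S.g)

theorem wprod_mem (w : List (Fin (2 * S.r))) : S.wprod w ∈ S.SGroup := by
  apply Subgroup.list_prod_mem
  intro x hx
  obtain ⟨a, -, rfl⟩ := List.mem_map.mp hx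
  exact Subgroup.subset_closure ⟨a, rfl⟩

/-- `γ_𝐚` as an element of the Schottky group `Γ`. -/
noncomputable def wprodG (w : List (Fin (2 * S.r))) : S.SGroup := ⟨S.wprod w, S.wprod_mem w⟩

/-- The generator `γ_a` as an element of `Γ`. -/
noncomputable def genG (a : Fin (2 * S.r)) : S.SGroup :=
  ⟨S.g a, Subgroup.subset_closure ⟨a, rfl⟩⟩

/-- The interval `I_𝐚 = γ_{𝐚'}(I_{a_n})` of a nonempty word. -/
noncomputable def Iset (w : List (Fin (2 * S.r))) : Set ℝ :=
  if h : w = [] then ∅ else mobiusR (S.wprod w.dropLast) '' S.Ireal (w.getLast h)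

/-- `Υ_𝐚 = |I_𝐚|`, the length of the interval `I_𝐚`; `Υ_∅ = 1`. -/
noncomputable def ups (w : List (Fin (2 * S.r))) : ℝ :=
  if w = [] then 1 else (volume (S.Iset w)).toReal

/-- The Bourgain–Dyatlov partition `Z(τ)`. -/
def Zset (τ : ℝ) : Set (List (Fin (2 * S.r))) :=
  {w | IsWord w ∧ w ≠ [] ∧ S.ups w ≤ τ ∧ τ < S.ups w.dropLast}

/-- The mirror set `Z̄(τ) = {𝐚 ∈ 𝒲 : 𝐚̄ ∈ Z(τ)}`. -/
def Zbar (τ : ℝ) : Set (List (Fin (2 * S.r))) :=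
  {w | IsWord w ∧ mirror w ∈ S.Zset τ}

open Classical in
/-- The Bowen–Series map on the Riemann sphere (junk value `∞` off `𝐃`). -/
noncomputable def TS (z : OnePoint ℂ) : OnePoint ℂ :=
  if h : ∃ a : Fin (2 * S.r), ∃ w : ℂ, z = (w : OnePoint ℂ) ∧ w ∈ S.D a
  then mobiusS (S.g h.choose)⁻¹ z
  else OnePoint.infty

/-- The limit set `Λ`: points of `𝐃` all of whose forward iterates under the Bowen–Series
map are defined (finite) and remain in `𝐃`. -/
def limitSet : Set ℂ :=
  {z : ℂ | ∀ n : ℕ, ∃ w : ℂ, (S.TS)^[n] (z : OnePoint ℂ) = (w : OnePoint ℂ) ∧ w ∈ S.Dall}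

/-- The limit set, viewed inside `ℝ`. -/
def limitSetR : Set ℝ := {x : ℝ | (x : ℂ) ∈ S.limitSet}

/-- `δ`, the Hausdorff dimension of the limit set. -/
noncomputable def delta : ℝ := (dimH S.limitSet).toReal

/-- `PowerPairs(τ)`: pairs `(𝐚,𝐛) ∈ Z̄(τ)²` such that `γ_{𝐚'}γ_{𝐛'}⁻¹` is a nontrivial
proper power in `Γ`. -/
def PowerPairs (τ : ℝ) : Set (List (Fin (2 * S.r)) × List (Fin (2 * S.r))) :=
  {p | p.1 ∈ S.Zbar τ ∧ p.2 ∈ S.Zbar τ ∧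
    S.wprod p.1.dropLast * (S.wprod p.2.dropLast)⁻¹ ≠ 1 ∧
    ∃ γ₀ ∈ S.SGroup, ∃ q : ℕ, 2 ≤ q ∧
      S.wprod p.1.dropLast * (S.wprod p.2.dropLast)⁻¹ = (γ₀ : SL2) ^ q}

end Schottky

section Words

variable {r : ℕ}

theorem wordBar_val (a : Fin (2 * r)) :
    (wordBar a).1 = if a.1 < r then a.1 + r else a.1 - r := by
  have := a.isLt
  split_ifs with h
  · exact Nat.mod_eq_of_lt (by omega)
  · change (a.1 + r) % (2 * r) = _
    rw [Nat.mod_eq_sub_mod (by omega), Nat.mod_eq_of_lt (by omega)]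
    omega

@[simp]
theorem wordBar_wordBar (a : Fin (2 * r)) : wordBar (wordBar a) = a := by
  have := a.isLt
  ext
  rw [wordBar_val, wordBar_val]
  split_ifs <;> omega

theorem wordBar_ne (a : Fin (2 * r)) : wordBar a ≠ a := by
  have := a.isLt
  intro h
  have h' := congrArg Fin.val h
  rw [wordBar_val] at h'
  split_ifs at h' <;> omega

theorem isWord_append {u v : List (Fin (2 * r))} :
    IsWord (u ++ v) ↔ IsWord u ∧ IsWord v ∧ arrow u v :=
  List.isChain_append

theorem IsWord.left {u v : List (Fin (2 * r))} (h : IsWord (u ++ v)) : IsWord u :=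
  (isWord_append.1 h).1

theorem IsWord.right {u v : List (Fin (2 * r))} (h : IsWord (u ++ v)) : IsWord v :=
  (isWord_append.1 h).2.1

theorem isWord_nil : IsWord ([] : List (Fin (2 * r))) := List.isChain_nil

theorem isWord_singleton (a : Fin (2 * r)) : IsWord [a] := List.isChain_singleton a

theorem isWord_cons_cons {a b : Fin (2 * r)} {v : List (Fin (2 * r))} :
    IsWord (a :: b :: v) ↔ a ≠ wordBar b ∧ IsWord (b :: v) :=
  List.isChain_cons_cons

@[simp]
theorem mirror_nil : mirror ([] : List (Fin (2 * r))) = [] := rfl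

@[simp]
theorem mirror_cons (a : Fin (2 * r)) (v : List (Fin (2 * r))) :
    mirror (a :: v) = mirror v ++ [wordBar a] := by
  simp [mirror]

@[simp]
theorem mirror_append (u v : List (Fin (2 * r))) : mirror (u ++ v) = mirror v ++ mirror u := by
  simp [mirror]

@[simp]
theorem mirror_mirror (w : List (Fin (2 * r))) : mirror (mirror w) = w := by
  induction w with
  | nil => rfl
  | cons a v ih => simp [ih]

@[simp]
theorem mirror_eq_nil {w : List (Fin (2 * r))} : mirror w = [] ↔ w = [] := by
  simp [mirror]

@[simp]
theorem length_mirror (w : List (Fin (2 * r))) : (mirror w).length = w.length := by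
  simp [mirror]

theorem IsWord.mirror {w : List (Fin (2 * r))} (h : IsWord w) : IsWord (mirror w) := by
  refine List.isChain_reverse.2 ((List.isChain_map _).2 (List.IsChain.imp ?_ h))
  intro x y hxy h'
  rw [wordBar_wordBar] at h'
  exact hxy h'.symm

/-- Two reduced words, stripped of their longest common suffix, concatenate without cancellation. -/
theorem exists_common_suffix (a b : List (Fin (2 * r))) (ha : IsWord a) (hb : IsWord b) :
    ∃ u v c, a = u ++ c ∧ b = v ++ c ∧ IsWord (u ++ mirror v) := by
  induction a using List.reverseRecOn generalizing b with
  | nil => exact ⟨[], b, [], by simp, by simp, by simpa using hb.mirror⟩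
  | append_singleton a x ih =>
    rcases List.eq_nil_or_concat' b with rfl | ⟨b, y, rfl⟩
    · exact ⟨a ++ [x], [], [], by simp, by simp, by simpa using ha⟩
    · by_cases hxy : x = y
      · subst hxy
        obtain ⟨u, v, c, rfl, rfl, h⟩ := ih b ha.left (by simpa using hb.left)
        exact ⟨u, v, c ++ [x], by simp, by simp, h⟩
      · refine ⟨a ++ [x], b ++ [y], [], by simp, by simp, isWord_append.2 ⟨ha, hb.mirror, ?_⟩⟩
        simpa [arrow] using hxy

/-- Every reduced word is conjugate, without cancellation, to a cyclically reduced one. -/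
theorem exists_conj_cyclic (n : ℕ) (y : List (Fin (2 * r))) (hn : y.length ≤ n) (hy : IsWord y) :
    ∃ p s, y = p ++ s ++ mirror p ∧ IsWord (s ++ s) := by
  induction n generalizing y with
  | zero =>
    obtain rfl : y = [] := List.length_eq_zero_iff.1 (by omega)
    exact ⟨[], [], rfl, isWord_nil⟩
  | succ n ih =>
    rcases y with _ | ⟨a, t⟩
    · exact ⟨[], [], rfl, isWord_nil⟩
    · rcases List.eq_nil_or_concat' t with rfl | ⟨t, b, rfl⟩
      · refine ⟨[], [a], by simp, isWord_append.2 ⟨hy, hy, ?_⟩⟩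
        simpa [arrow] using (wordBar_ne a).symm
      · by_cases hab : b = wordBar a
        · obtain ⟨p, s, rfl, h⟩ := ih t (by simp at hn; omega)
            (IsWord.left (u := t) (IsWord.right (u := [a]) hy))
          exact ⟨a :: p, s, by simp [hab], h⟩
        · refine ⟨[], a :: (t ++ [b]), by simp, isWord_append.2 ⟨hy, hy, ?_⟩⟩
          intro x hx z hz
          rw [← List.cons_append, List.getLast?_concat] at hx
          obtain rfl : b = x := by simpa using hx
          obtain rfl : a = z := by simpa using hz
          exact hab

/-- The `q`-fold concatenation of a word. -/
def wordPow (s : List (Fin (2 * r))) (q : ℕ) : List (Fin (2 * r)) := (List.replicate q s).flatten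

@[simp]
theorem wordPow_zero (s : List (Fin (2 * r))) : wordPow s 0 = [] := rfl

theorem wordPow_succ (s : List (Fin (2 * r))) (q : ℕ) : wordPow s (q + 1) = s ++ wordPow s q := rfl

theorem le_length_wordPow {s : List (Fin (2 * r))} (hs : s ≠ []) (q : ℕ) :
    q ≤ (wordPow s q).length := by
  have := List.length_pos_iff.2 hs
  induction q with
  | zero => simp
  | succ q ih => rw [wordPow_succ, List.length_append]; omega

theorem isWord_conj_wordPow {p s : List (Fin (2 * r))} (hs : s ≠ [])
    (h : IsWord (p ++ s ++ mirror p)) (hss : IsWord (s ++ s)) (q : ℕ) :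
    IsWord (p ++ wordPow s (q + 1) ++ mirror p) := by
  obtain ⟨hps, hp', hpp⟩ := isWord_append.1 h
  obtain ⟨hp, hs', hps'⟩ := isWord_append.1 hps
  have key : ∀ q, IsWord (wordPow s (q + 1) ++ mirror p) := by
    intro q
    induction q with
    | zero =>
      simp only [wordPow, List.replicate, List.flatten]
      exact IsWord.right (u := p) (by simpa using h)
    | succ q ih =>
      rw [wordPow_succ, List.append_assoc]
      refine isWord_append.2 ⟨hs', ih, fun x hx y hy => (isWord_append.1 hss).2.2 x hx y ?_⟩
      rwa [wordPow_succ, List.append_assoc, List.head?_append_of_ne_nil _ hs] at hy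
  rw [List.append_assoc]
  refine isWord_append.2 ⟨hp, key q, fun x hx y hy => hps' x hx y ?_⟩
  rwa [wordPow_succ, List.append_assoc, List.head?_append_of_ne_nil _ hs] at hy

end Words

section Moebius

theorem SL2.det_eq (g : SL2) : g.1 0 0 * g.1 1 1 - g.1 0 1 * g.1 1 0 = 1 := by
  rw [← Matrix.det_fin_two, g.2]

theorem SL2.mul_apply (g h : SL2) (i j : Fin 2) :
    (g * h).1 i j = g.1 i 0 * h.1 0 j + g.1 i 1 * h.1 1 j := by
  simp [Matrix.mul_apply, Fin.sum_univ_two]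

theorem SL2.inv_apply (g : SL2) :
    g⁻¹.1 0 0 = g.1 1 1 ∧ g⁻¹.1 0 1 = -g.1 0 1 ∧ g⁻¹.1 1 0 = -g.1 1 0 ∧ g⁻¹.1 1 1 = g.1 0 0 := by
  simp [Matrix.adjugate_fin_two]

/-- The denominator of the Möbius transformation of `g` at `x`. -/
def mobiusDen (g : SL2) (x : ℝ) : ℝ := g.1 1 0 * x + g.1 1 1

theorem mobiusDen_mul (g h : SL2) (x : ℝ) (hx : mobiusDen h x ≠ 0) :
    mobiusDen (g * h) x = mobiusDen g (mobiusR h x) * mobiusDen h x := by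
  simp only [mobiusDen, mobiusR, SL2.mul_apply] at *
  field_simp
  ring

theorem mobiusR_mul (g h : SL2) (x : ℝ) (hx : mobiusDen h x ≠ 0) :
    mobiusR (g * h) x = mobiusR g (mobiusR h x) := by
  have h1 := mobiusDen_mul g h x hx
  have h2 : (g * h).1 0 0 * x + (g * h).1 0 1 =
      (g.1 0 0 * mobiusR h x + g.1 0 1) * mobiusDen h x := by
    simp only [mobiusDen, mobiusR, SL2.mul_apply] at *
    field_simp
    ring
  change _ / mobiusDen (g * h) x = _ / mobiusDen g (mobiusR h x)
  rw [h1, h2, mul_div_mul_right _ _ hx]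

theorem mobiusR_sub (g : SL2) {x y : ℝ} (hx : mobiusDen g x ≠ 0) (hy : mobiusDen g y ≠ 0) :
    mobiusR g x - mobiusR g y = (x - y) / (mobiusDen g x * mobiusDen g y) := by
  have hd := SL2.det_eq g
  change _ / mobiusDen g x - _ / mobiusDen g y = _
  rw [div_sub_div _ _ hx hy]
  congr 1
  simp only [mobiusDen]
  linear_combination (x - y) * hd

theorem mobiusR_injOn (g : SL2) {x y : ℝ} (hx : mobiusDen g x ≠ 0) (hy : mobiusDen g y ≠ 0)
    (h : mobiusR g x = mobiusR g y) : x = y := by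
  have h1 := mobiusR_sub g hx hy
  rw [h, sub_self, eq_comm, div_eq_zero_iff] at h1
  rcases h1 with h1 | h1
  · linarith
  · exact absurd h1 (mul_ne_zero hx hy)

theorem mobiusDen_inv (g : SL2) {x : ℝ} (hx : mobiusDen g x ≠ 0) :
    mobiusDen g⁻¹ (mobiusR g x) = (mobiusDen g x)⁻¹ := by
  obtain ⟨h1, h2, h3, h4⟩ := SL2.inv_apply g
  have hd := SL2.det_eq g
  simp only [mobiusDen, mobiusR, h3, h4] at *
  field_simp
  linear_combination hd

theorem mobiusR_inv (g : SL2) {x : ℝ} (hx : mobiusDen g x ≠ 0) :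
    mobiusR g⁻¹ (mobiusR g x) = x := by
  rw [← mobiusR_mul _ _ _ hx]
  simp [mobiusR]

/-- The image `γ(∞)` of infinity (junk if it is infinite). -/
noncomputable def mobiusInfty (g : SL2) : ℝ := g.1 0 0 / g.1 1 0

theorem mobiusDen_eq (g : SL2) (hg : g.1 1 0 ≠ 0) (x : ℝ) :
    mobiusDen g x = g.1 1 0 * (x - mobiusInfty g⁻¹) := by
  obtain ⟨h1, h2, h3, h4⟩ := SL2.inv_apply g
  simp only [mobiusDen, mobiusInfty, h1, h3]
  field_simp
  ring

theorem SL2.mul_lower (g h : SL2) (hh : h.1 1 0 ≠ 0) :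
    (g * h).1 1 0 = mobiusDen g (mobiusInfty h) * h.1 1 0 := by
  simp only [mobiusDen, mobiusInfty, SL2.mul_apply]
  field_simp

theorem mobiusInfty_mul (g h : SL2) (hh : h.1 1 0 ≠ 0) :
    mobiusInfty (g * h) = mobiusR g (mobiusInfty h) := by
  have h1 := SL2.mul_lower g h hh
  have h2 : (g * h).1 0 0 = (g.1 0 0 * mobiusInfty h + g.1 0 1) * h.1 1 0 := by
    simp only [mobiusInfty, SL2.mul_apply]
    field_simp
  rw [mobiusInfty, h1, h2, mul_div_mul_right _ _ hh]
  rfl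

theorem mobiusR_sub_infty (g : SL2) (hg : g.1 1 0 ≠ 0) {x : ℝ} (hx : mobiusDen g x ≠ 0) :
    mobiusR g x - mobiusInfty g = -1 / (g.1 1 0 * mobiusDen g x) := by
  have hd := SL2.det_eq g
  change _ / mobiusDen g x - _ / _ = _
  rw [div_sub_div _ _ hx hg]
  congr 1
  · simp only [mobiusDen]
    linear_combination -hd
  · exact mul_comm _ _

end Moebius

namespace Schottky

variable (S : Schottky)

/-- The closed interval `closure(D_a) ∩ ℝ`. -/
def J (a : Fin (2 * S.r)) : Set ℝ := {x | |x - S.center a| ≤ S.radius a}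

variable {S}

theorem mem_closedDisc {a : Fin (2 * S.r)} {x : ℝ} :
    (x : ℂ) ∈ Metric.closedBall (S.center a : ℂ) (S.radius a) ↔ x ∈ S.J a := by
  rw [Metric.mem_closedBall, Complex.dist_eq, ← Complex.ofReal_sub, Complex.norm_real]
  rfl

theorem mem_D {a : Fin (2 * S.r)} {x : ℝ} :
    (x : ℂ) ∈ S.D a ↔ |x - S.center a| < S.radius a := by
  rw [D, Metric.mem_ball, Complex.dist_eq, ← Complex.ofReal_sub, Complex.norm_real]
  rfl

theorem Ireal_eq (a : Fin (2 * S.r)) :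
    S.Ireal a = Set.Ioo (S.center a - S.radius a) (S.center a + S.radius a) := by
  ext x
  rw [Ireal, Set.mem_ofPred_eq, mem_D, abs_lt, Set.mem_Ioo]
  constructor <;> rintro ⟨h1, h2⟩ <;> constructor <;> linarith

theorem radius_add_lt {a b : Fin (2 * S.r)} (hab : a ≠ b) :
    S.radius a + S.radius b < |S.center a - S.center b| := by
  have h := S.disjoint a b hab
  rw [closure_ball _ (S.radius_pos a).ne', closure_ball _ (S.radius_pos b).ne',
    disjoint_closedBall_closedBall_iff (S.radius_pos a).le (S.radius_pos b).le,
    Complex.dist_eq, ← Complex.ofReal_sub, Complex.norm_real] at h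
  exact h

theorem notMem_J {a b : Fin (2 * S.r)} (hab : a ≠ b) {x : ℝ} (hx : x ∈ S.J a) : x ∉ S.J b := by
  intro hx'
  have h := radius_add_lt hab
  have h1 : |S.center a - S.center b| ≤ |x - S.center a| + |x - S.center b| := by
    rw [abs_sub_comm x]
    exact abs_sub_le _ _ _
  have h2 : |x - S.center a| ≤ S.radius a := hx
  have h3 : |x - S.center b| ≤ S.radius b := hx'
  linarith

/-- The closed intervals are uniformly separated and uniformly bounded. -/
theorem exists_sep (S : Schottky) : ∃ m M : ℝ, 0 < m ∧ m ≤ M ∧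
    (∀ a b, a ≠ b → ∀ x ∈ S.J a, ∀ y ∈ S.J b, m ≤ |x - y|) ∧
    ∀ a b, ∀ x ∈ S.J a, ∀ y ∈ S.J b, |x - y| ≤ M := by
  have hfin : ∃ m : ℝ, 0 < m ∧ ∀ p : Fin (2 * S.r) × Fin (2 * S.r), p.1 ≠ p.2 →
      m ≤ |S.center p.1 - S.center p.2| - S.radius p.1 - S.radius p.2 := by
    have := Finset.univ (α := Fin (2 * S.r) × Fin (2 * S.r)).finite_toSet
    have h : ∀ p : Fin (2 * S.r) × Fin (2 * S.r), ∃ m : ℝ, 0 < m ∧ (p.1 ≠ p.2 →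
      m ≤ |S.center p.1 - S.center p.2| - S.radius p.1 - S.radius p.2) := by
      intro p
      by_cases hp : p.1 = p.2
      · exact ⟨1, one_pos, fun h => absurd hp h⟩
      · exact ⟨_, by linarith [radius_add_lt hp], fun _ => le_rfl⟩
    choose f hf0 hf using h
    have : Nonempty (Fin (2 * S.r)) := ⟨⟨0, by have := S.two_le_r; omega⟩⟩
    obtain ⟨p0, hp0⟩ := Finite.exists_min f
    exact ⟨f p0, hf0 p0, fun p hp => (hp0 p).trans (hf p hp)⟩
  obtain ⟨m, hm, hsep⟩ := hfin
  set N : ℝ := ∑ a, (|S.center a| + S.radius a) with hN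
  have hb : ∀ a, ∀ x ∈ S.J a, |x| ≤ N := by
    intro a x hx
    have h1 : |S.center a| + S.radius a ≤ N :=
      Finset.single_le_sum (f := fun a => |S.center a| + S.radius a)
        (fun b _ => add_nonneg (abs_nonneg _) (S.radius_pos b).le) (Finset.mem_univ a)
    have h2 : |x| ≤ |x - S.center a| + |S.center a| := by
      simpa using abs_add_le (x - S.center a) (S.center a)
    have h3 : |x - S.center a| ≤ S.radius a := hx
    linarith
  refine ⟨m, max m (N + N), hm, le_max_left _ _, fun a b hab x hx y hy => ?_,
    fun a b x hx y hy => ?_⟩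
  · have h0 := hsep (a, b) hab
    have h1 : |S.center a - S.center b| ≤ |x - S.center a| + |x - S.center b| := by
      rw [abs_sub_comm x]
      exact abs_sub_le _ _ _
    have h2 : |x - S.center b| ≤ |x - y| + |y - S.center b| := abs_sub_le _ _ _
    have h3 : |x - S.center a| ≤ S.radius a := hx
    have h4 : |y - S.center b| ≤ S.radius b := hy
    simp only at h0
    linarith
  · refine le_trans ?_ (le_max_right _ _)
    calc |x - y| ≤ |x| + |y| := abs_sub _ _
      _ ≤ _ := add_le_add (hb a x hx) (hb b y hy)

theorem mobiusS_mem {a : Fin (2 * S.r)} {z : OnePoint ℂ}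
    (hz : ∀ w : ℂ, z = w → w ∉ Metric.ball (S.center (wordBar a) : ℂ) (S.radius (wordBar a))) :
    ∃ w ∈ Metric.closedBall (S.center a : ℂ) (S.radius a),
      mobiusS (S.g a) z = (w : OnePoint ℂ) := by
  have h : mobiusS (S.g a) z ∈
      (fun w : ℂ => (w : OnePoint ℂ)) '' closure (Metric.ball (S.center a : ℂ) (S.radius a)) := by
    rw [← S.maps a]
    refine ⟨z, ?_, rfl⟩
    rintro ⟨w, hw, rfl⟩
    exact hz w rfl hw
  obtain ⟨w, hw, h⟩ := h
  exact ⟨w, Metric.closure_ball_subset_closedBall hw, h.symm⟩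

theorem mobiusS_ofReal (g : SL2) (x : ℝ) : mobiusS g ((x : ℂ) : OnePoint ℂ) =
    if mobiusDen g x = 0 then OnePoint.infty else ((mobiusR g x : ℂ) : OnePoint ℂ) := by
  have h1 : ((g.1 1 0 : ℂ) * x + (g.1 1 1 : ℂ)) = ((mobiusDen g x : ℝ) : ℂ) := by
    simp [mobiusDen]
  have h2 : mobiusC g x = ((mobiusR g x : ℝ) : ℂ) := by
    simp [mobiusC, mobiusR]
  change (if ((g.1 1 0 : ℂ) * x + (g.1 1 1 : ℂ)) = 0 then OnePoint.infty
      else ((mobiusC g x : ℂ) : OnePoint ℂ)) = _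
  rw [h1, h2]
  simp only [Complex.ofReal_eq_zero]

theorem gen_mem {a : Fin (2 * S.r)} {x : ℝ}
    (hx : S.radius (wordBar a) ≤ |x - S.center (wordBar a)|) :
    mobiusDen (S.g a) x ≠ 0 ∧ mobiusR (S.g a) x ∈ S.J a := by
  obtain ⟨w, hw, h⟩ := mobiusS_mem (a := a) (z := ((x : ℂ) : OnePoint ℂ)) (by
    intro w hw hw'
    rw [OnePoint.coe_eq_coe] at hw
    subst hw
    exact absurd (mem_D.1 hw') (not_lt.2 hx))
  rw [mobiusS_ofReal] at h
  split_ifs at h with h0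
  · exact absurd h (OnePoint.infty_ne_coe w)
  · rw [OnePoint.coe_eq_coe] at h
    subst h
    exact ⟨h0, mem_closedDisc.1 hw⟩

theorem gen_mem_open {a : Fin (2 * S.r)} {x : ℝ} (hx : x ∉ S.J (wordBar a)) :
    mobiusDen (S.g a) x ≠ 0 ∧ |mobiusR (S.g a) x - S.center a| < S.radius a := by
  obtain ⟨h1, h2⟩ := gen_mem (a := a) (not_le.1 hx).le
  refine ⟨h1, lt_of_not_ge fun h => hx ?_⟩
  obtain ⟨h3, h4⟩ := gen_mem (a := wordBar a) (x := mobiusR (S.g a) x)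
    (by rwa [wordBar_wordBar])
  rwa [S.g_bar, mobiusR_inv _ h1] at h4

theorem gen_infty (a : Fin (2 * S.r)) : (S.g a).1 1 0 ≠ 0 ∧ mobiusInfty (S.g a) ∈ S.J a := by
  obtain ⟨w, hw, h⟩ := mobiusS_mem (a := a) (z := OnePoint.infty)
    (fun w hw => absurd hw (OnePoint.infty_ne_coe w))
  change (if ((S.g a).1 1 0 : ℝ) = 0 then OnePoint.infty
    else ((((S.g a).1 0 0 / (S.g a).1 1 0 : ℝ) : ℂ) : OnePoint ℂ)) = _ at h
  split_ifs at h with h0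
  · exact absurd h (OnePoint.infty_ne_coe w)
  · rw [OnePoint.coe_eq_coe] at h
    subst h
    exact ⟨h0, mem_closedDisc.1 hw⟩

@[simp]
theorem wprod_nil : S.wprod [] = 1 := rfl

@[simp]
theorem wprod_cons (a : Fin (2 * S.r)) (v : List (Fin (2 * S.r))) :
    S.wprod (a :: v) = S.g a * S.wprod v := by
  simp [wprod]

@[simp]
theorem wprod_append (u v : List (Fin (2 * S.r))) :
    S.wprod (u ++ v) = S.wprod u * S.wprod v := by
  simp [wprod]

@[simp]
theorem wprod_mirror (w : List (Fin (2 * S.r))) : S.wprod (mirror w) = (S.wprod w)⁻¹ := by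
  induction w with
  | nil => simp
  | cons a v ih => simp [ih, S.g_bar]

theorem wprod_wordPow (s : List (Fin (2 * S.r))) (q : ℕ) :
    S.wprod (wordPow s q) = S.wprod s ^ q := by
  induction q with
  | zero => simp
  | succ q ih => rw [wordPow_succ, wprod_append, ih, pow_succ']

theorem word_infty {a : Fin (2 * S.r)} {v : List (Fin (2 * S.r))} (h : IsWord (a :: v)) :
    (S.wprod (a :: v)).1 1 0 ≠ 0 ∧ mobiusInfty (S.wprod (a :: v)) ∈ S.J a := by
  induction v generalizing a with
  | nil => simpa using gen_infty a
  | cons b v ih =>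
    rw [isWord_cons_cons] at h
    obtain ⟨h1, h2⟩ := ih h.2
    have h3 : mobiusInfty (S.wprod (b :: v)) ∉ S.J (wordBar a) :=
      notMem_J (fun e => h.1 (by rw [e, wordBar_wordBar])) h2
    obtain ⟨h4, h5⟩ := gen_mem_open h3
    rw [wprod_cons a]
    refine ⟨?_, ?_⟩
    · rw [SL2.mul_lower _ _ h1]
      exact mul_ne_zero h4 h1
    · rw [mobiusInfty_mul _ _ h1]
      exact h5.le

theorem word_lower_ne_zero {w : List (Fin (2 * S.r))} (h : IsWord w) (hw : w ≠ []) :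
    (S.wprod w).1 1 0 ≠ 0 := by
  obtain ⟨a, v, rfl⟩ := List.exists_cons_of_ne_nil hw
  exact (word_infty h).1

theorem word_pole {e : Fin (2 * S.r)} {w : List (Fin (2 * S.r))} (h : IsWord (w ++ [e])) :
    mobiusInfty (S.wprod (w ++ [e]))⁻¹ ∈ S.J (wordBar e) := by
  rw [← wprod_mirror, mirror_append]
  have h' := h.mirror
  rw [mirror_append] at h'
  exact (word_infty h').2

/-- Distinct reduced words give distinct elements of `SL(2,ℝ)`. -/
theorem wprod_injOn {u v : List (Fin (2 * S.r))} (hu : IsWord u) (hv : IsWord v)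
    (h : S.wprod u = S.wprod v) : u = v := by
  obtain ⟨u', v', c, rfl, rfl, hw⟩ := exists_common_suffix u v hu hv
  by_cases hn : u' ++ mirror v' = []
  · simp only [List.append_eq_nil_iff, mirror_eq_nil] at hn
    rw [hn.1, hn.2]
  · refine absurd ?_ (S.word_lower_ne_zero hw hn)
    rw [wprod_append, wprod_append, mul_left_inj] at h
    rw [wprod_append, wprod_mirror, h, mul_inv_cancel]
    simp

/-- Every element of the Schottky group comes from a reduced word. -/
theorem exists_word {x : SL2} (hx : x ∈ S.SGroup) : ∃ w, IsWord w ∧ S.wprod w = x := by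
  induction hx using Subgroup.closure_induction with
  | mem x hx =>
    obtain ⟨a, rfl⟩ := hx
    exact ⟨[a], isWord_singleton a, by simp⟩
  | one => exact ⟨[], isWord_nil, rfl⟩
  | mul x y _ _ hx hy =>
    obtain ⟨u, hu, rfl⟩ := hx
    obtain ⟨v, hv, rfl⟩ := hy
    obtain ⟨u', v', c, rfl, h2, hw⟩ := exists_common_suffix u (mirror v) hu hv.mirror
    refine ⟨_, hw, ?_⟩
    rw [← mirror_mirror v, h2]
    simp [mul_assoc]
  | inv x _ hx =>
    obtain ⟨u, hu, rfl⟩ := hx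
    exact ⟨_, hu.mirror, wprod_mirror u⟩

end Schottky

theorem mobiusDen_mul_pos {g : SL2} {α β x : ℝ} (h : 0 < mobiusDen g α * mobiusDen g β)
    (hx : x ∈ Set.Icc α β) : 0 < mobiusDen g α * mobiusDen g x := by
  obtain ⟨h1, h2⟩ := hx
  rcases h1.eq_or_lt with rfl | h1
  · exact mul_self_pos.2 (left_ne_zero_of_mul h.ne')
  · have h3 : (β - α) * (mobiusDen g α * mobiusDen g x) =
        (β - x) * (mobiusDen g α * mobiusDen g α)
          + (x - α) * (mobiusDen g α * mobiusDen g β) := by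
      simp only [mobiusDen]; ring
    have h4 : 0 < (x - α) * (mobiusDen g α * mobiusDen g β) := mul_pos (by linarith) h
    have h5 : 0 ≤ (β - x) * (mobiusDen g α * mobiusDen g α) :=
      mul_nonneg (by linarith) (mul_self_nonneg _)
    exact pos_of_mul_pos_right (a := β - α) (by rw [h3]; linarith) (by linarith)

/-- A Möbius transformation whose pole is outside an interval maps it increasingly
onto an interval. -/
theorem mobiusR_image_Ioo {g : SL2} {α β : ℝ} (hαβ : α < β)
    (h : 0 < mobiusDen g α * mobiusDen g β) :
    mobiusR g '' Set.Ioo α β = Set.Ioo (mobiusR g α) (mobiusR g β) := by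
  have hα : mobiusDen g α ≠ 0 := left_ne_zero_of_mul h.ne'
  have hβ : mobiusDen g β ≠ 0 := right_ne_zero_of_mul h.ne'
  have hx0 : ∀ x ∈ Set.Icc α β, mobiusDen g x ≠ 0 := fun x hx =>
    right_ne_zero_of_mul (mobiusDen_mul_pos h hx).ne'
  apply Set.Subset.antisymm
  · rintro _ ⟨x, hx, rfl⟩
    have hx' := Set.Ioo_subset_Icc_self hx
    have h1 := mobiusDen_mul_pos h hx'
    have h2 : 0 < mobiusDen g β * mobiusDen g x := by
      have h3 : 0 < (mobiusDen g α * mobiusDen g α) * (mobiusDen g β * mobiusDen g x) := by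
        have := mul_pos h h1
        nlinarith
      exact pos_of_mul_pos_right h3 (mul_self_nonneg _)
    constructor
    · rw [← sub_pos, mobiusR_sub g (hx0 x hx') hα]
      exact div_pos (by linarith [hx.1]) (by rwa [mul_comm])
    · rw [← sub_pos, mobiusR_sub g hβ (hx0 x hx')]
      exact div_pos (by linarith [hx.2]) h2
  · refine intermediate_value_Ioo hαβ.le (ContinuousOn.div ?_ ?_ hx0)
    · fun_prop
    · fun_prop

namespace Schottky

variable {S : Schottky}

/-- The absolute value of the lower left entry of `γ_w` (`1` for the empty word). -/
noncomputable def size (w : List (Fin (2 * S.r))) : ℝ :=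
  if w = [] then 1 else |(S.wprod w).1 1 0|

@[simp]
theorem size_nil : S.size [] = 1 := if_pos rfl

theorem size_of_ne_nil {w : List (Fin (2 * S.r))} (hw : w ≠ []) :
    S.size w = |(S.wprod w).1 1 0| := if_neg hw

theorem size_pos {w : List (Fin (2 * S.r))} (h : IsWord w) : 0 < S.size w := by
  by_cases hw : w = []
  · simp [hw]
  · rw [size_of_ne_nil hw]
    exact abs_pos.2 (word_lower_ne_zero h hw)

theorem size_mirror (w : List (Fin (2 * S.r))) : S.size (mirror w) = S.size w := by
  by_cases hw : w = []
  · simp [hw]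
  · rw [size_of_ne_nil hw, size_of_ne_nil (by simpa using hw), wprod_mirror,
      (SL2.inv_apply _).2.2.1, abs_neg]

/-- The denominator of `γ_w` at a point which is not in the interval containing its pole. -/
theorem exists_den_bound (S : Schottky) : ∃ m M : ℝ, 0 < m ∧ 1 ≤ M ∧
    ∀ w a, IsWord (w ++ [a]) → ∀ x ∈ S.J a,
      m * S.size w ≤ |mobiusDen (S.wprod w) x| ∧ |mobiusDen (S.wprod w) x| ≤ M * S.size w := by
  obtain ⟨m, M, hm, hmM, hsep, hbd⟩ := S.exists_sep
  refine ⟨min 1 m, max 1 M, lt_min one_pos hm, le_max_left _ _, fun w a hw x hx => ?_⟩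
  rcases List.eq_nil_or_concat' w with rfl | ⟨w, e, rfl⟩
  · simp [mobiusDen]
  · have hp := S.word_pole (isWord_append.1 hw).1
    have hne : a ≠ wordBar e := by
      rintro rfl
      have := (isWord_append.1 hw).2.2
      simp [arrow] at this
    have hpos := S.size_pos (isWord_append.1 hw).1
    have h1 := hsep _ _ hne x hx _ hp
    have h2 := hbd _ _ x hx _ hp
    rw [mobiusDen_eq _ (word_lower_ne_zero hw.left (by simp)), abs_mul,
      ← size_of_ne_nil (by simp), mul_comm (S.size _)]
    exact ⟨mul_le_mul_of_nonneg_right ((min_le_right _ _).trans h1) hpos.le,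
      mul_le_mul_of_nonneg_right (h2.trans (le_max_right _ _)) hpos.le⟩

theorem den_ne_zero {w : List (Fin (2 * S.r))} {a : Fin (2 * S.r)} (h : IsWord (w ++ [a])) {x : ℝ}
    (hx : x ∈ S.J a) : mobiusDen (S.wprod w) x ≠ 0 := by
  obtain ⟨m, M, hm, -, hb⟩ := S.exists_den_bound
  exact abs_pos.1 ((mul_pos hm (size_pos h.left)).trans_le (hb w a h x hx).1)

/-- The size is multiplicative up to constants. -/
theorem exists_size_mul (S : Schottky) : ∃ K : ℝ, 1 ≤ K ∧
    ∀ u v : List (Fin (2 * S.r)), IsWord (u ++ v) →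
      S.size (u ++ v) ≤ K * (S.size u * S.size v) ∧
      S.size u * S.size v ≤ K * S.size (u ++ v) := by
  obtain ⟨m, M, hm, hM, hb⟩ := S.exists_den_bound
  refine ⟨max M m⁻¹, le_max_of_le_left hM, fun u v h => ?_⟩
  have hM' : M ≤ max M m⁻¹ := le_max_left _ _
  have hm' : m⁻¹ ≤ max M m⁻¹ := le_max_right _ _
  have hK1 : 1 ≤ max M m⁻¹ := hM.trans hM'
  rcases v with _ | ⟨a, v⟩
  · have := S.size_pos h.left
    simp only [List.append_nil, size_nil, mul_one]
    constructor <;> nlinarith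
  · have hu : IsWord (u ++ [a]) := IsWord.left (v := v) (by simpa using h)
    obtain ⟨h1, h2⟩ := word_infty h.right
    obtain ⟨h3, h4⟩ := hb u a hu _ h2
    have hpos := S.size_pos h.right
    have hposu := S.size_pos h.left
    rw [size_of_ne_nil (w := u ++ a :: v) (by simp), wprod_append, SL2.mul_lower _ _ h1, abs_mul,
      ← size_of_ne_nil (by simp)]
    constructor
    · rw [← mul_assoc]
      exact mul_le_mul_of_nonneg_right (h4.trans (mul_le_mul_of_nonneg_right hM' hposu.le)) hpos.le
    · rw [← mul_assoc]
      refine mul_le_mul_of_nonneg_right ?_ hpos.le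
      calc S.size u = m⁻¹ * (m * S.size u) := by field_simp
        _ ≤ m⁻¹ * |mobiusDen (S.wprod u) (mobiusInfty (S.wprod (a :: v)))| := by gcongr
        _ ≤ _ := by gcongr

theorem Iset_append_singleton (w : List (Fin (2 * S.r))) (a : Fin (2 * S.r)) :
    S.Iset (w ++ [a]) = mobiusR (S.wprod w) '' S.Ireal a := by
  simp [Iset]

theorem left_mem_J (a : Fin (2 * S.r)) : S.center a - S.radius a ∈ S.J a := by
  have := S.radius_pos a
  simp [J, abs_of_pos this]

theorem right_mem_J (a : Fin (2 * S.r)) : S.center a + S.radius a ∈ S.J a := by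
  have := S.radius_pos a
  simp [J, abs_of_pos this]

theorem Ireal_subset_J {a : Fin (2 * S.r)} {x : ℝ} (hx : x ∈ S.Ireal a) : x ∈ S.J a :=
  (mem_D.1 hx).le

theorem den_mul_den_pos {w : List (Fin (2 * S.r))} {a : Fin (2 * S.r)} (h : IsWord (w ++ [a])) :
    0 < mobiusDen (S.wprod w) (S.center a - S.radius a) *
      mobiusDen (S.wprod w) (S.center a + S.radius a) := by
  rcases List.eq_nil_or_concat' w with rfl | ⟨w, e, rfl⟩
  · simp [mobiusDen]
  · have hp := S.word_pole (isWord_append.1 h).1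
    have hne : wordBar e ≠ a := by
      rintro rfl
      have := (isWord_append.1 h).2.2
      simp [arrow] at this
    have h1 : S.radius a < |mobiusInfty (S.wprod (w ++ [e]))⁻¹ - S.center a| :=
      not_le.1 (notMem_J hne hp)
    have h0 := S.word_lower_ne_zero (isWord_append.1 h).1 (by simp)
    rw [mobiusDen_eq _ h0, mobiusDen_eq _ h0]
    have h2 := sq_lt_sq' (by linarith [S.radius_pos a]) h1
    rw [sq_abs] at h2
    have h3 : 0 < (S.wprod (w ++ [e])).1 1 0 ^ 2 := by positivity
    nlinarith [mul_pos h3 (sub_pos.2 h2)]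

/-- The interval `I_w` of a nonempty word is a bounded open interval of the expected length. -/
theorem exists_Iset_eq {w : List (Fin (2 * S.r))} {a : Fin (2 * S.r)} (h : IsWord (w ++ [a])) :
    ∃ α β, α ≤ β ∧ S.Iset (w ++ [a]) = Set.Ioo α β ∧ S.ups (w ++ [a]) = β - α ∧
      β - α = 2 * S.radius a / (mobiusDen (S.wprod w) (S.center a - S.radius a) *
        mobiusDen (S.wprod w) (S.center a + S.radius a)) := by
  have hpos := den_mul_den_pos h
  have hr := S.radius_pos a
  have h1 := mobiusR_image_Ioo (g := S.wprod w) (α := S.center a - S.radius a)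
    (β := S.center a + S.radius a) (by linarith) hpos
  have h2 := mobiusR_sub (S.wprod w) (right_ne_zero_of_mul hpos.ne') (left_ne_zero_of_mul hpos.ne')
  rw [mul_comm (mobiusDen _ _), show S.center a + S.radius a - (S.center a - S.radius a)
    = 2 * S.radius a by ring] at h2
  have h3 : 0 ≤ mobiusR (S.wprod w) (S.center a + S.radius a) -
      mobiusR (S.wprod w) (S.center a - S.radius a) := by
    rw [h2]; positivity
  have h4 : S.Iset (w ++ [a]) = Set.Ioo (mobiusR (S.wprod w) (S.center a - S.radius a))
      (mobiusR (S.wprod w) (S.center a + S.radius a)) := by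
    rw [Iset_append_singleton, Ireal_eq, h1]
  refine ⟨_, _, sub_nonneg.1 h3, h4, ?_, h2⟩
  rw [ups, if_neg (by simp), h4, Real.volume_Ioo, ENNReal.toReal_ofReal h3]

/-- The length of `I_{wa}` is comparable to the inverse square of the size of `w`. -/
theorem exists_ups_bound (S : Schottky) : ∃ K : ℝ, 1 ≤ K ∧
    ∀ w a, IsWord (w ++ [a]) →
      S.ups (w ++ [a]) * S.size w ^ 2 ≤ K ∧ 1 ≤ K * (S.ups (w ++ [a]) * S.size w ^ 2) := by
  obtain ⟨m, M, hm, hM, hb⟩ := S.exists_den_bound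
  have : Nonempty (Fin (2 * S.r)) := ⟨⟨0, by have := S.two_le_r; omega⟩⟩
  obtain ⟨a₀, ha₀⟩ := Finite.exists_min S.radius
  obtain ⟨a₁, ha₁⟩ := Finite.exists_max S.radius
  have hr₀ := S.radius_pos a₀
  have hr₁ := S.radius_pos a₁
  set K := max 1 (max (2 * S.radius a₁ / m ^ 2) (M ^ 2 / (2 * S.radius a₀)))
  have hK1 : 2 * S.radius a₁ / m ^ 2 ≤ K := (le_max_left _ _).trans (le_max_right _ _)
  have hK2 : M ^ 2 / (2 * S.radius a₀) ≤ K := (le_max_right _ _).trans (le_max_right _ _)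
  refine ⟨K, le_max_left _ _, fun w a h => ?_⟩
  obtain ⟨α, β, -, -, h1, h2⟩ := exists_Iset_eq h
  have hpos := den_mul_den_pos h
  have hs := S.size_pos h.left
  obtain ⟨h3, h4⟩ := hb w a h _ (left_mem_J a)
  obtain ⟨h5, h6⟩ := hb w a h _ (right_mem_J a)
  rw [h1, h2]
  rw [← abs_of_pos hpos, abs_mul] at *
  set P := |mobiusDen (S.wprod w) (S.center a - S.radius a)|
  set Q := |mobiusDen (S.wprod w) (S.center a + S.radius a)|
  have hP : 0 < P := lt_of_lt_of_le (by positivity) h3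
  have hQ : 0 < Q := lt_of_lt_of_le (by positivity) h5
  have h7 : (m * S.size w) * (m * S.size w) ≤ P * Q :=
    mul_le_mul h3 h5 (by positivity) hP.le
  have h8 : P * Q ≤ (M * S.size w) * (M * S.size w) :=
    mul_le_mul h4 h6 hQ.le (by positivity)
  have ha : S.radius a₀ ≤ S.radius a := ha₀ a
  have ha' : S.radius a ≤ S.radius a₁ := ha₁ a
  have hra := S.radius_pos a
  constructor
  · refine le_trans ?_ hK1
    rw [div_mul_eq_mul_div, div_le_div_iff₀ (by positivity) (by positivity)]
    calc 2 * S.radius a * S.size w ^ 2 * m ^ 2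
        = 2 * S.radius a * ((m * S.size w) * (m * S.size w)) := by ring
      _ ≤ 2 * S.radius a₁ * (P * Q) := by gcongr
  · calc (1 : ℝ) = M ^ 2 / (2 * S.radius a₀) *
          (2 * S.radius a₀ / ((M * S.size w) * (M * S.size w)) * S.size w ^ 2) := by
          field_simp
      _ ≤ _ := by gcongr

theorem exists_letter (a b : Fin (2 * S.r)) : ∃ c, c ≠ a ∧ c ≠ b := by
  have h : ({a, b} : Finset (Fin (2 * S.r))).card <
      (Finset.univ : Finset (Fin (2 * S.r))).card := by
    have := S.two_le_r
    rw [Finset.card_univ, Fintype.card_fin]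
    exact Finset.card_le_two.trans_lt (by omega)
  obtain ⟨c, -, hc⟩ := Finset.exists_mem_notMem_of_card_lt_card h
  simp only [Finset.mem_insert, Finset.mem_singleton, not_or] at hc
  exact ⟨c, hc⟩

theorem isWord_append_singleton {w : List (Fin (2 * S.r))} {e a : Fin (2 * S.r)}
    (h : IsWord (w ++ [e])) (ha : a ≠ wordBar e) : IsWord (w ++ [e] ++ [a]) := by
  refine isWord_append.2 ⟨h, isWord_singleton a, ?_⟩
  have : e ≠ wordBar a := fun h => ha (by rw [h, wordBar_wordBar])
  simpa [arrow] using this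

theorem Iset_subset {w : List (Fin (2 * S.r))} {e a : Fin (2 * S.r)}
    (h : IsWord (w ++ [e] ++ [a])) : S.Iset (w ++ [e] ++ [a]) ⊆ S.Iset (w ++ [e]) := by
  rw [Iset_append_singleton, Iset_append_singleton]
  have hne : a ≠ wordBar e := by
    rintro rfl
    have := (isWord_append.1 h).2.2
    simp [arrow] at this
  rintro _ ⟨x, hx, rfl⟩
  obtain ⟨h1, h2⟩ := gen_mem_open (notMem_J hne (Ireal_subset_J hx))
  refine ⟨mobiusR (S.g e) x, mem_D.2 h2, ?_⟩
  rw [wprod_append, wprod_cons, wprod_nil, mul_one, mobiusR_mul _ _ _ h1]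

theorem ups_add_le {w : List (Fin (2 * S.r))} {e a b : Fin (2 * S.r)} (hab : a ≠ b)
    (ha : IsWord (w ++ [e] ++ [a])) (hb : IsWord (w ++ [e] ++ [b])) :
    S.ups (w ++ [e] ++ [a]) + S.ups (w ++ [e] ++ [b]) ≤ S.ups (w ++ [e]) := by
  have hd : Disjoint (S.Iset (w ++ [e] ++ [a])) (S.Iset (w ++ [e] ++ [b])) := by
    rw [Iset_append_singleton, Iset_append_singleton, Set.disjoint_left]
    rintro _ ⟨x, hx, rfl⟩ ⟨y, hy, hxy⟩
    have := mobiusR_injOn _ (den_ne_zero hb (Ireal_subset_J hy))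
      (den_ne_zero ha (Ireal_subset_J hx)) hxy
    subst this
    exact notMem_J hab (Ireal_subset_J hx) (Ireal_subset_J hy)
  have hsub := Set.union_subset (Iset_subset ha) (Iset_subset hb)
  obtain ⟨α, β, -, h1, -⟩ := exists_Iset_eq ha
  obtain ⟨α', β', -, h2, -⟩ := exists_Iset_eq hb
  obtain ⟨α'', β'', -, h3, -⟩ := exists_Iset_eq ha.left
  rw [ups, ups, ups, if_neg (by simp), if_neg (by simp), if_neg (by simp)]
  rw [h1, h2, h3] at hsub
  rw [h1, h2] at hd
  rw [h1, h2, h3, ← ENNReal.toReal_add (by simp) (by simp), ← measure_union hd measurableSet_Ioo]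
  exact ENNReal.toReal_mono (by simp) (measure_mono hsub)

/-- Interval lengths decay exponentially in the word length. -/
theorem exists_ups_le_pow (S : Schottky) : ∃ C θ : ℝ, 0 < C ∧ 0 < θ ∧ θ < 1 ∧
    ∀ w : List (Fin (2 * S.r)), IsWord w → S.ups w ≤ C * θ ^ w.length := by
  obtain ⟨K, hK, hb⟩ := S.exists_ups_bound
  set θ : ℝ := (1 + (K ^ 2)⁻¹)⁻¹ with hθ
  have hK2 : 0 < (K ^ 2)⁻¹ := by positivity
  have hθ0 : 0 < θ := by positivity
  have hθ1 : θ < 1 := inv_lt_one_of_one_lt₀ (by linarith)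
  refine ⟨K / θ, θ, by positivity, hθ0, hθ1, fun w hw => ?_⟩
  have h0 : ∀ a, S.ups [a] ≤ K := fun a => by
    simpa using (hb [] a (isWord_singleton a)).1
  have hstep : ∀ w e a, IsWord (w ++ [e] ++ [a]) →
      S.ups (w ++ [e] ++ [a]) ≤ θ * S.ups (w ++ [e]) := by
    intro w e a h
    obtain ⟨b, hba, hbe⟩ := exists_letter a (wordBar e)
    have h' := isWord_append_singleton h.left hbe
    have h1 := ups_add_le hba.symm h h'
    have h2 := (hb _ _ h).1
    have h3 := (hb _ _ h').2
    have hs := S.size_pos h.left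
    have h4 : (K ^ 2)⁻¹ * S.ups (w ++ [e] ++ [a]) ≤ S.ups (w ++ [e] ++ [b]) := by
      rw [inv_mul_le_iff₀ (by positivity)]
      refine le_of_mul_le_mul_right (h2.trans ?_) (pow_pos hs 2)
      nlinarith
    rw [hθ, ← div_eq_inv_mul, le_div_iff₀ (by positivity)]
    linarith
  induction w using List.reverseRecOn with
  | nil =>
    simp only [List.length_nil, pow_zero, mul_one, ups, if_true]
    rw [le_div_iff₀ hθ0]
    linarith
  | append_singleton w a ih =>
    rcases List.eq_nil_or_concat' w with rfl | ⟨w, e, rfl⟩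
    · simpa [hθ0.ne'] using h0 a
    · refine (hstep w e a hw).trans ?_
      calc θ * S.ups (w ++ [e]) ≤ θ * (K / θ * θ ^ (w ++ [e]).length) := by
            gcongr
            exact ih hw.left
        _ = _ := by rw [List.length_append (as := w ++ [e]), pow_add]; simp; ring

/-- Sizes grow exponentially in the word length. -/
theorem exists_pow_le_size (S : Schottky) : ∃ C lam : ℝ, 0 < C ∧ 1 < lam ∧
    ∀ w : List (Fin (2 * S.r)), IsWord w → lam ^ w.length ≤ C * S.size w ^ 2 := by
  obtain ⟨C, θ, hC, hθ0, hθ1, hu⟩ := S.exists_ups_le_pow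
  obtain ⟨K, hK, hb⟩ := S.exists_ups_bound
  refine ⟨K * C, θ⁻¹, by positivity, (one_lt_inv₀ hθ0).2 hθ1, fun w hw => ?_⟩
  have : ∃ a, IsWord (w ++ [a]) := by
    rcases List.eq_nil_or_concat' w with rfl | ⟨w, e, rfl⟩
    · exact ⟨⟨0, by have := S.two_le_r; omega⟩, isWord_singleton _⟩
    · obtain ⟨b, -, hbe⟩ := exists_letter e (wordBar e)
      exact ⟨b, isWord_append_singleton hw hbe⟩
  obtain ⟨a, ha⟩ := this
  have h1 := (hb w a ha).2
  have h2 := hu _ ha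
  have hs := S.size_pos hw
  rw [inv_pow, inv_le_iff_one_le_mul₀ (by positivity)]
  calc (1 : ℝ) ≤ K * (S.ups (w ++ [a]) * S.size w ^ 2) := h1
    _ ≤ K * ((C * θ ^ (w ++ [a]).length) * S.size w ^ 2) := by gcongr
    _ ≤ K * ((C * θ ^ w.length) * S.size w ^ 2) := by
      gcongr K * ((C * ?_) * S.size w ^ 2)
      exact pow_le_pow_of_le_one hθ0.le hθ1.le (by simp)
    _ = _ := by ring

end Schottky

section Sequences

variable {A : Type*}

/-- The word formed by the first `n` letters of a sequence. -/
def seqPrefix (ω : ℕ → A) (n : ℕ) : List A := (List.range n).map ω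

/-- The `n`-th shift of a sequence. -/
def seqShift (n : ℕ) (ω : ℕ → A) : ℕ → A := fun i => ω (n + i)

@[simp]
theorem seqPrefix_zero (ω : ℕ → A) : seqPrefix ω 0 = [] := rfl

@[simp]
theorem length_seqPrefix (ω : ℕ → A) (n : ℕ) : (seqPrefix ω n).length = n := by
  simp [seqPrefix]

theorem seqPrefix_succ (ω : ℕ → A) (n : ℕ) : seqPrefix ω (n + 1) = seqPrefix ω n ++ [ω n] := by
  simp [seqPrefix, List.range_succ]

theorem seqPrefix_add (ω : ℕ → A) (n j : ℕ) :
    seqPrefix ω (n + j) = seqPrefix ω n ++ seqPrefix (seqShift n ω) j := by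
  simp [seqPrefix, List.range_add, seqShift]

theorem seqPrefix_succ' (ω : ℕ → A) (n : ℕ) :
    seqPrefix ω (n + 1) = ω 0 :: seqPrefix (seqShift 1 ω) n := by
  rw [add_comm, seqPrefix_add, seqPrefix_succ]
  simp

theorem seqPrefix_congr {ω ω' : ℕ → A} {n : ℕ} (h : ∀ i < n, ω i = ω' i) :
    seqPrefix ω n = seqPrefix ω' n :=
  List.map_congr_left fun i hi => h i (List.mem_range.1 hi)

end Sequences

namespace Schottky

open Filter Topology

variable (S : Schottky)

/-- The infinite reduced words. -/
def seqs : Set (ℕ → Fin (2 * S.r)) := {ω | ∀ n, ω n ≠ wordBar (ω (n + 1))}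

/-- The boundary point encoded by an infinite reduced word. -/
noncomputable def limPt (ω : ℕ → Fin (2 * S.r)) : ℝ :=
  limUnder atTop fun n => mobiusInfty (S.wprod (seqPrefix ω (n + 1)))

variable {S}

theorem seqShift_mem {ω : ℕ → Fin (2 * S.r)} (hω : ω ∈ S.seqs) (n : ℕ) :
    seqShift n ω ∈ S.seqs := fun i => hω (n + i)

theorem isWord_seqPrefix {ω : ℕ → Fin (2 * S.r)} (hω : ω ∈ S.seqs) (n : ℕ) :
    IsWord (seqPrefix ω n) := by
  induction n with
  | zero => exact isWord_nil
  | succ n ih =>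
    rw [seqPrefix_succ]
    refine isWord_append.2 ⟨ih, isWord_singleton _, ?_⟩
    rcases n with _ | n
    · simp [arrow]
    · rw [seqPrefix_succ]
      simpa [arrow] using hω n

theorem isWord_seqPrefix_append {ω : ℕ → Fin (2 * S.r)} (hω : ω ∈ S.seqs) (n : ℕ) :
    IsWord (seqPrefix ω n ++ [ω n]) := by
  rw [← seqPrefix_succ]
  exact isWord_seqPrefix hω _

theorem seq_infty_mem {ω : ℕ → Fin (2 * S.r)} (hω : ω ∈ S.seqs) (n : ℕ) :
    mobiusInfty (S.wprod (seqPrefix ω (n + 1))) ∈ S.J (ω 0) := by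
  have h := isWord_seqPrefix hω (n + 1)
  rw [seqPrefix_succ'] at h ⊢
  exact (word_infty h).2

theorem seq_infty_add {ω : ℕ → Fin (2 * S.r)} (hω : ω ∈ S.seqs) (n j : ℕ) :
    mobiusInfty (S.wprod (seqPrefix ω (n + (j + 1)))) =
      mobiusR (S.wprod (seqPrefix ω n))
        (mobiusInfty (S.wprod (seqPrefix (seqShift n ω) (j + 1)))) := by
  rw [seqPrefix_add, wprod_append, mobiusInfty_mul]
  refine word_lower_ne_zero (isWord_seqPrefix (seqShift_mem hω n) _) ?_
  simp [seqPrefix_succ]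

theorem tendsto_limPt {ω : ℕ → Fin (2 * S.r)} (hω : ω ∈ S.seqs) :
    Tendsto (fun n => mobiusInfty (S.wprod (seqPrefix ω (n + 1)))) atTop (𝓝 (S.limPt ω)) := by
  obtain ⟨m, M, hm, -, hb⟩ := S.exists_den_bound
  obtain ⟨C, lam, hC, hlam, hl⟩ := S.exists_pow_le_size
  refine CauchySeq.tendsto_limUnder (cauchySeq_of_le_geometric lam⁻¹ (m⁻¹ * C)
    (inv_lt_one_of_one_lt₀ hlam) fun n => ?_)
  have h1 := seq_infty_mem (seqShift_mem hω (n + 1)) 0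
  have hw := isWord_seqPrefix_append hω (n + 1)
  have hx : mobiusInfty (S.wprod (seqPrefix (seqShift (n + 1) ω) (0 + 1))) ∈ S.J (ω (n + 1)) := h1
  have h2 := (hb _ _ hw _ hx).1
  have h3 := hl _ (isWord_seqPrefix hω (n + 1))
  have hne : seqPrefix ω (n + 1) ≠ [] := by simp [seqPrefix_succ]
  rw [dist_comm, Real.dist_eq, show n + 1 + 1 = n + 1 + (0 + 1) by ring, seq_infty_add hω,
    mobiusR_sub_infty _ (word_lower_ne_zero hw.left hne) (den_ne_zero hw hx), abs_div, abs_neg,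
    abs_one, abs_mul, ← size_of_ne_nil hne]
  have hs := S.size_pos hw.left
  rw [length_seqPrefix] at h3
  have h4 : lam ^ n ≤ C * S.size (seqPrefix ω (n + 1)) ^ 2 :=
    (pow_le_pow_right₀ hlam.le (by omega)).trans h3
  calc _ ≤ 1 / (S.size (seqPrefix ω (n + 1)) * (m * S.size (seqPrefix ω (n + 1)))) := by gcongr
    _ = m⁻¹ * C * (C * S.size (seqPrefix ω (n + 1)) ^ 2)⁻¹ := by field_simp
    _ ≤ m⁻¹ * C * (lam ^ n)⁻¹ := by gcongr
    _ = _ := by rw [inv_pow]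

theorem limPt_mem {ω : ℕ → Fin (2 * S.r)} (hω : ω ∈ S.seqs) : S.limPt ω ∈ S.J (ω 0) :=
  le_of_tendsto (((tendsto_limPt hω).sub_const _).abs) (Eventually.of_forall (seq_infty_mem hω))

theorem limPt_shift_mem {ω : ℕ → Fin (2 * S.r)} (hω : ω ∈ S.seqs) (n : ℕ) :
    S.limPt (seqShift n ω) ∈ S.J (ω n) := limPt_mem (seqShift_mem hω n)

theorem limPt_eq {ω : ℕ → Fin (2 * S.r)} (hω : ω ∈ S.seqs) (n : ℕ) :
    S.limPt ω = mobiusR (S.wprod (seqPrefix ω n)) (S.limPt (seqShift n ω)) := by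
  have h1 : Tendsto (fun j => mobiusInfty (S.wprod (seqPrefix ω (n + (j + 1))))) atTop
      (𝓝 (S.limPt ω)) := by
    have := (tendsto_limPt hω).comp (tendsto_add_atTop_nat n)
    refine this.congr fun j => ?_
    simp only [Function.comp_apply]
    congr 3
    omega
  have h0 := den_ne_zero (isWord_seqPrefix_append hω n) (limPt_shift_mem hω n)
  have hc : ContinuousAt (mobiusR (S.wprod (seqPrefix ω n))) (S.limPt (seqShift n ω)) :=
    ContinuousAt.div (by fun_prop) (by fun_prop) h0
  refine tendsto_nhds_unique h1 ?_
  simp only [seq_infty_add hω]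
  exact hc.tendsto.comp (tendsto_limPt (seqShift_mem hω n))

/-- Sequences that first differ at position `n` encode points at distance comparable to the
length of the interval of their common prefix. -/
theorem exists_limPt_sep (S : Schottky) : ∃ c : ℝ, 0 < c ∧
    ∀ ω ∈ S.seqs, ∀ ω' ∈ S.seqs, ∀ n, (∀ i < n, ω i = ω' i) → ω n ≠ ω' n →
      c * (S.size (seqPrefix ω n) ^ 2)⁻¹ ≤ |S.limPt ω - S.limPt ω'| := by
  obtain ⟨m, M, hm, -, hsep, -⟩ := S.exists_sep
  obtain ⟨m', M', -, hM', hb⟩ := S.exists_den_bound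
  refine ⟨m * (M' ^ 2)⁻¹, by positivity, fun ω hω ω' hω' n hi hn => ?_⟩
  have hw := isWord_seqPrefix_append hω n
  have hw' := isWord_seqPrefix_append hω' n
  have hs := S.size_pos hw.left
  rw [limPt_eq hω n, limPt_eq hω' n, ← seqPrefix_congr hi]
  rw [← seqPrefix_congr hi] at hw'
  have h0 := limPt_shift_mem hω n
  have h0' := limPt_shift_mem hω' n
  have h1 := (hb _ _ hw _ h0).2
  have h2 := (hb _ _ hw' _ h0').2
  have h3 := hsep _ _ hn _ h0 _ h0'
  have h4 := den_ne_zero hw h0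
  have h5 := den_ne_zero hw' h0'
  rw [mobiusR_sub _ h4 h5, abs_div, abs_mul]
  have h4' := abs_pos.2 h4
  have h5' := abs_pos.2 h5
  calc _ = m / ((M' * S.size (seqPrefix ω n)) * (M' * S.size (seqPrefix ω n))) := by field_simp
    _ ≤ _ := by gcongr

theorem ne_wordBar_of_mem {ω : ℕ → Fin (2 * S.r)} (hω : ω ∈ S.seqs) (n : ℕ) :
    ω (n + 1) ≠ wordBar (ω n) := fun h => hω n (by rw [h, wordBar_wordBar])

theorem limPt_mem_D {ω : ℕ → Fin (2 * S.r)} (hω : ω ∈ S.seqs) :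
    (S.limPt ω : ℂ) ∈ S.D (ω 0) := by
  rw [mem_D, limPt_eq hω 1]
  have h := (gen_mem_open (notMem_J (ne_wordBar_of_mem hω 0) (limPt_shift_mem hω 1))).2
  simpa [seqPrefix_succ] using h

theorem TS_limPt {ω : ℕ → Fin (2 * S.r)} (hω : ω ∈ S.seqs) :
    S.TS ((S.limPt ω : ℂ) : OnePoint ℂ) = ((S.limPt (seqShift 1 ω) : ℂ) : OnePoint ℂ) := by
  have hD := limPt_mem_D hω
  have hex : ∃ a : Fin (2 * S.r), ∃ w : ℂ,
      ((S.limPt ω : ℂ) : OnePoint ℂ) = (w : OnePoint ℂ) ∧ w ∈ S.D a := ⟨_, _, rfl, hD⟩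
  rw [TS, dif_pos hex]
  have hc : hex.choose = ω 0 := by
    obtain ⟨w, hw, hw'⟩ := hex.choose_spec
    rw [OnePoint.coe_eq_coe] at hw
    rw [← hw] at hw'
    by_contra hne
    exact notMem_J hne (x := S.limPt ω) (mem_D.1 hw').le (mem_D.1 hD).le
  rw [hc]
  have h1 := (gen_mem_open (notMem_J (ne_wordBar_of_mem hω 0) (limPt_shift_mem hω 1))).1
  have h2 : S.limPt ω = mobiusR (S.g (ω 0)) (S.limPt (seqShift 1 ω)) := by
    simpa [seqPrefix_succ] using limPt_eq hω 1
  rw [h2, mobiusS_ofReal, if_neg, mobiusR_inv _ h1]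
  rw [mobiusDen_inv _ h1]
  exact inv_ne_zero h1

theorem limPt_mem_limitSet {ω : ℕ → Fin (2 * S.r)} (hω : ω ∈ S.seqs) :
    (S.limPt ω : ℂ) ∈ S.limitSet := by
  have key : ∀ n, S.TS^[n] ((S.limPt ω : ℂ) : OnePoint ℂ) =
      ((S.limPt (seqShift n ω) : ℂ) : OnePoint ℂ) := by
    intro n
    induction n with
    | zero => rw [show seqShift 0 ω = ω from funext fun i => by simp [seqShift]]; rfl
    | succ n ih =>
      rw [Function.iterate_succ_apply', ih, TS_limPt (seqShift_mem hω n)]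
      congr 3
      funext i
      simp only [seqShift]
      congr 1
      ring
  exact fun n => ⟨_, key n, Set.mem_iUnion.2 ⟨_, limPt_mem_D (seqShift_mem hω n)⟩⟩

theorem const_mem_seqs (a : Fin (2 * S.r)) : (fun _ => a) ∈ S.seqs := fun _ =>
  (wordBar_ne a).symm

theorem exists_prefix_small {ω : ℕ → Fin (2 * S.r)} (hω : ω ∈ S.seqs) {η : ℝ} (hη : 0 < η) :
    ∃ n, (S.size (seqPrefix ω n) ^ 2)⁻¹ ≤ η := by
  obtain ⟨C, lam, hC, hlam, hl⟩ := S.exists_pow_le_size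
  obtain ⟨n, hn⟩ := pow_unbounded_of_one_lt (C * η⁻¹) hlam
  refine ⟨n, ?_⟩
  have h1 := hl _ (isWord_seqPrefix hω n)
  have h2 := S.size_pos (isWord_seqPrefix hω n)
  rw [length_seqPrefix] at h1
  rw [inv_le_comm₀ (by positivity) hη]
  exact le_of_mul_le_mul_left (hn.le.trans h1) hC

/-- A set of infinite words is contained in a single cylinder, whose size is either arbitrarily
small or controlled by the diameter of the set of encoded points. -/
theorem exists_cylinder (S : Schottky) : ∃ c : ℝ, 0 < c ∧ ∀ B ⊆ S.seqs, ∀ η : ℝ, 0 < η →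
    ∃ w, IsWord w ∧ (∀ ω ∈ B, seqPrefix ω w.length = w) ∧
      ((S.size w ^ 2)⁻¹ ≤ η ∨
        ∃ ω ∈ B, ∃ ω' ∈ B, c * (S.size w ^ 2)⁻¹ ≤ |S.limPt ω - S.limPt ω'|) := by
  obtain ⟨c, hc, hsep⟩ := S.exists_limPt_sep
  refine ⟨c, hc, fun B hB η hη => ?_⟩
  classical
  by_cases hd : ∃ n, ∃ ω ∈ B, ∃ ω' ∈ B, ω n ≠ ω' n
  · obtain ⟨ω, hω, ω', hω', hne⟩ := Nat.find_spec hd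
    have hmin : ∀ i < Nat.find hd, ∀ ω₁ ∈ B, ∀ ω₂ ∈ B, ω₁ i = ω₂ i := by
      intro i hi ω₁ h₁ ω₂ h₂
      by_contra h
      exact Nat.find_min hd hi ⟨ω₁, h₁, ω₂, h₂, h⟩
    refine ⟨seqPrefix ω (Nat.find hd), isWord_seqPrefix (hB hω) _, fun ω₁ h₁ => ?_,
      Or.inr ⟨ω, hω, ω', hω', ?_⟩⟩
    · rw [length_seqPrefix]
      exact seqPrefix_congr fun i hi => hmin i hi _ h₁ _ hω
    · exact hsep _ (hB hω) _ (hB hω') _ (fun i hi => hmin i hi _ hω _ hω') hne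
  · push Not at hd
    obtain ⟨ω, hω, hB'⟩ : ∃ ω ∈ S.seqs, ∀ ω' ∈ B, ω' = ω := by
      rcases B.eq_empty_or_nonempty with rfl | ⟨ω, hω⟩
      · exact ⟨_, const_mem_seqs ⟨0, by have := S.two_le_r; omega⟩, by simp⟩
      · exact ⟨ω, hB hω, fun ω' hω' => funext fun n => hd n _ hω' _ hω⟩
    obtain ⟨n, hn⟩ := exists_prefix_small hω hη
    refine ⟨_, isWord_seqPrefix hω n, fun ω' hω' => ?_, Or.inl hn⟩
    rw [hB' ω' hω', length_seqPrefix]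

theorem isCompact_seqs (S : Schottky) : IsCompact S.seqs := by
  refine IsClosed.isCompact ?_
  have : S.seqs = ⋂ n, {ω | ω n ≠ wordBar (ω (n + 1))} := by
    ext; simp [seqs]
  rw [this]
  refine isClosed_iInter fun n => ?_
  have hcont : Continuous fun ω : ℕ → Fin (2 * S.r) => (ω n, ω (n + 1)) := by fun_prop
  exact (isClosed_discrete {p : Fin (2 * S.r) × Fin (2 * S.r) | p.1 ≠ wordBar p.2}).preimage hcont

theorem isOpen_cylinder (w : List (Fin (2 * S.r))) :
    IsOpen {ω : ℕ → Fin (2 * S.r) | seqPrefix ω w.length = w} := by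
  rw [isOpen_iff_mem_nhds]
  intro ω hω
  have ho : IsOpen (⋂ i ∈ Finset.range w.length, {ω' : ℕ → Fin (2 * S.r) | ω' i = ω i}) := by
    refine isOpen_biInter_finset fun i _ => ?_
    have hcont : Continuous fun ω' : ℕ → Fin (2 * S.r) => ω' i := continuous_apply i
    exact (isOpen_discrete {ω i}).preimage hcont
  refine mem_of_superset (ho.mem_nhds (by simp)) fun ω' hω' => ?_
  have h1 : ∀ i < w.length, ω' i = ω i := by simpa using hω'
  exact (seqPrefix_congr h1).trans hω

theorem delta_nonneg (S : Schottky) : 0 ≤ S.delta := ENNReal.toReal_nonneg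

theorem hausdorffMeasure_limitSet {s : ℝ} (hs : S.delta < s) : μH[s] S.limitSet = 0 := by
  have hs0 : 0 ≤ s := S.delta_nonneg.trans hs.le
  have hfin : dimH S.limitSet ≠ ⊤ := by
    refine ne_top_of_le_ne_top ?_ (dimH_mono (Set.subset_univ _))
    rw [Real.dimH_univ_eq_finrank ℂ]
    simp
  lift s to NNReal using hs0
  refine hausdorffMeasure_of_dimH_lt ?_
  rw [← ENNReal.ofReal_coe_nnreal, ENNReal.lt_ofReal_iff_toReal_lt hfin]
  exact hs

/-- For `s > δ` the infinite words are covered by finitely many cylinders of arbitrarily small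
total weight. -/
theorem exists_cylinder_cover {s : ℝ} (hs : S.delta < s) {ε : ℝ} (hε : 0 < ε) :
    ∃ (T : Finset ℕ) (w : ℕ → List (Fin (2 * S.r))), (∀ n, IsWord (w n)) ∧
      (∀ ω ∈ S.seqs, ∃ n ∈ T, seqPrefix ω (w n).length = w n) ∧
      ∑ n ∈ T, ((S.size (w n) ^ 2)⁻¹) ^ s ≤ ε := by
  have hs0 : 0 < s := S.delta_nonneg.trans_lt hs
  obtain ⟨c, hc, hcyl⟩ := S.exists_cylinder
  have hcs : 0 < c ^ s := Real.rpow_pos_of_pos hc s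
  have hμ := hausdorffMeasure_limitSet hs
  rw [Measure.hausdorffMeasure_apply] at hμ
  simp only [ENNReal.iSup_eq_zero] at hμ
  have hlt : (0 : ENNReal) < ENNReal.ofReal (c ^ s * (ε / 2)) := by
    rw [ENNReal.ofReal_pos]; positivity
  have h1 := hμ 1 one_pos
  rw [← h1] at hlt
  simp only [iInf_lt_iff] at hlt
  obtain ⟨t, hcov, -, hsum⟩ := hlt
  obtain ⟨e, he0, hesum⟩ := ENNReal.exists_pos_sum_of_countable
    (ε := ENNReal.ofReal (ε / 2)) (by rw [Ne, ENNReal.ofReal_eq_zero]; linarith) ℕ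
  have hchoice : ∀ n, ∃ w : List (Fin (2 * S.r)), IsWord w ∧
      (∀ ω ∈ S.seqs, (S.limPt ω : ℂ) ∈ t n → seqPrefix ω w.length = w) ∧
      ENNReal.ofReal (((S.size w ^ 2)⁻¹) ^ s) ≤ ENNReal.ofReal (c ^ s)⁻¹ *
        (⨆ _ : (t n).Nonempty, Metric.ediam (t n) ^ s) + e n := by
    intro n
    have he : (0 : ℝ) < e n := he0 n
    obtain ⟨w, hw, hpre, hsize⟩ := hcyl {ω ∈ S.seqs | (S.limPt ω : ℂ) ∈ t n}
      (fun ω hω => hω.1) ((e n : ℝ) ^ s⁻¹) (Real.rpow_pos_of_pos he _)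
    have hpos := S.size_pos hw
    have hpos2 : 0 < (S.size w ^ 2)⁻¹ := by positivity
    refine ⟨w, hw, fun ω hω hωt => hpre ω ⟨hω, hωt⟩, ?_⟩
    rcases hsize with hsize | ⟨ω, hω, ω', hω', hsize⟩
    · refine le_add_left ?_
      rw [ENNReal.ofReal_le_iff_le_toReal (by simp)]
      calc ((S.size w ^ 2)⁻¹) ^ s ≤ ((e n : ℝ) ^ s⁻¹) ^ s :=
            Real.rpow_le_rpow hpos2.le hsize hs0.le
        _ = e n := Real.rpow_inv_rpow he.le hs0.ne'
        _ = _ := by simp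
    · refine le_add_right ?_
      rw [iSup_pos ⟨_, hω.2⟩]
      have h2 : ENNReal.ofReal (c * (S.size w ^ 2)⁻¹) ≤ Metric.ediam (t n) := by
        refine le_trans ?_ (Metric.edist_le_ediam_of_mem hω.2 hω'.2)
        rw [edist_dist, Complex.dist_eq, ← Complex.ofReal_sub, Complex.norm_real]
        exact ENNReal.ofReal_le_ofReal hsize
      calc ENNReal.ofReal (((S.size w ^ 2)⁻¹) ^ s)
          = ENNReal.ofReal (c ^ s)⁻¹ * ENNReal.ofReal (c * (S.size w ^ 2)⁻¹) ^ s := by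
            rw [ENNReal.ofReal_rpow_of_pos (by positivity), ← ENNReal.ofReal_mul (by positivity),
              Real.mul_rpow hc.le hpos2.le, inv_mul_cancel_left₀ hcs.ne']
        _ ≤ _ := by gcongr
  choose w hw hpre hsize using hchoice
  obtain ⟨T, hT⟩ := S.isCompact_seqs.elim_finite_subcover
    (fun n => {ω : ℕ → Fin (2 * S.r) | seqPrefix ω (w n).length = w n})
    (fun n => isOpen_cylinder (w n)) (by
      intro ω hω
      obtain ⟨n, hn⟩ := Set.mem_iUnion.1 (hcov (limPt_mem_limitSet hω))
      exact Set.mem_iUnion.2 ⟨n, hpre n ω hω hn⟩)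
  refine ⟨T, w, hw, fun ω hω => by simpa using hT hω, ?_⟩
  have hnn : ∀ n, 0 ≤ ((S.size (w n) ^ 2)⁻¹) ^ s := fun n => by
    have := S.size_pos (hw n)
    positivity
  rw [← ENNReal.ofReal_le_ofReal_iff hε.le, ENNReal.ofReal_sum_of_nonneg fun n _ => hnn n]
  calc ∑ n ∈ T, ENNReal.ofReal (((S.size (w n) ^ 2)⁻¹) ^ s)
      ≤ ∑' n, ENNReal.ofReal (((S.size (w n) ^ 2)⁻¹) ^ s) := ENNReal.sum_le_tsum _
    _ ≤ ∑' n, (ENNReal.ofReal (c ^ s)⁻¹ *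
        (⨆ _ : (t n).Nonempty, Metric.ediam (t n) ^ s) + e n) := ENNReal.tsum_le_tsum hsize
    _ = ENNReal.ofReal (c ^ s)⁻¹ * (∑' n, ⨆ _ : (t n).Nonempty, Metric.ediam (t n) ^ s) +
        ∑' n, (e n : ENNReal) := by rw [ENNReal.tsum_add, ENNReal.tsum_mul_left]
    _ ≤ ENNReal.ofReal (c ^ s)⁻¹ * ENNReal.ofReal (c ^ s * (ε / 2)) +
        ENNReal.ofReal (ε / 2) := by
      gcongr
    _ = ENNReal.ofReal ε := by
      rw [← ENNReal.ofReal_mul (by positivity), inv_mul_cancel_left₀ hcs.ne',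
        ← ENNReal.ofReal_add (by positivity) (by positivity), add_halves]

open Classical in
/-- The reduced words of length at most `n`. -/
noncomputable def wordsLE (S : Schottky) (n : ℕ) : Finset (List (Fin (2 * S.r))) :=
  {w ∈ (List.finite_length_le (Fin (2 * S.r)) n).toFinset | IsWord w}

theorem mem_wordsLE {n : ℕ} {w : List (Fin (2 * S.r))} :
    w ∈ S.wordsLE n ↔ w.length ≤ n ∧ IsWord w := by
  simp [wordsLE]

theorem exists_extension {w : List (Fin (2 * S.r))} (h : IsWord w) (hw : w ≠ []) :
    ∃ ω ∈ S.seqs, seqPrefix ω w.length = w := by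
  refine ⟨fun i => w.getD i (w.getLast hw), fun n => ?_, ?_⟩
  · change w.getD n (w.getLast hw) ≠ wordBar (w.getD (n + 1) (w.getLast hw))
    rcases lt_trichotomy (n + 1) w.length with hn | hn | hn
    · rw [List.getD_eq_getElem _ _ (by omega), List.getD_eq_getElem _ _ hn]
      exact List.isChain_iff_getElem.1 h n hn
    · rw [List.getD_eq_getElem _ _ (by omega), List.getD_eq_default _ _ (by omega)]
      have : w[n]'(by omega) = w.getLast hw := by
        rw [List.getLast_eq_getElem]
        congr 1
        omega
      rw [this]
      exact (wordBar_ne _).symm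
    · rw [List.getD_eq_default _ _ (by omega), List.getD_eq_default _ _ (by omega)]
      exact (wordBar_ne _).symm
  · refine List.ext_getElem (by simp) fun i h1 h2 => ?_
    simp [seqPrefix, h2]

/-- The Poincaré series of the Schottky group converges at every exponent above `δ`. -/
theorem exists_poincare_bound {s : ℝ} (hs : S.delta < s) :
    ∃ B : ℝ, ∀ n, ∑ w ∈ S.wordsLE n, ((S.size w ^ 2)⁻¹) ^ s ≤ B := by
  classical
  have hs0 : 0 < s := S.delta_nonneg.trans_lt hs
  obtain ⟨K, hK, hmul⟩ := S.exists_size_mul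
  set f : List (Fin (2 * S.r)) → ℝ := fun w => ((S.size w ^ 2)⁻¹) ^ s with hf
  have hf0 : ∀ w, 0 ≤ f w := fun w => by positivity
  have hfmul : ∀ u v, IsWord (u ++ v) → f (u ++ v) ≤ (K ^ 2) ^ s * (f u * f v) := by
    intro u v h
    have h1 := (hmul u v h).2
    have hu := S.size_pos h.left
    have hv := S.size_pos h.right
    have huv := S.size_pos h
    simp only [hf]
    rw [← Real.mul_rpow (by positivity) (by positivity),
      ← Real.mul_rpow (by positivity) (by positivity)]
    refine Real.rpow_le_rpow (by positivity) ?_ hs0.le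
    rw [← mul_inv, ← div_eq_mul_inv, le_div_iff₀ (by positivity), inv_mul_le_iff₀ (by positivity)]
    calc S.size u ^ 2 * S.size v ^ 2 = (S.size u * S.size v) ^ 2 := by ring
      _ ≤ (K * S.size (u ++ v)) ^ 2 := by gcongr
      _ = _ := by ring
  have hKs : 0 < (K ^ 2) ^ s := by positivity
  obtain ⟨T, w, hw, hcov, hsum⟩ := exists_cylinder_cover hs (ε := ((K ^ 2) ^ s)⁻¹ / 2)
    (by positivity)
  set L := T.sup (fun i => (w i).length) + 1 with hL
  refine ⟨2 * ∑ v ∈ S.wordsLE L, f v, fun n => ?_⟩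
  have hsub : S.wordsLE n ⊆ S.wordsLE L ∪
      T.biUnion fun i => {v ∈ S.wordsLE n | IsWord (w i ++ v)}.image (w i ++ ·) := by
    intro v hv
    rw [mem_wordsLE] at hv
    rw [Finset.mem_union]
    by_cases hvL : v.length ≤ L
    · exact Or.inl (mem_wordsLE.2 ⟨hvL, hv.2⟩)
    · right
      obtain ⟨ω, hω, hpre⟩ := exists_extension hv.2 (by rintro rfl; simp at hvL)
      obtain ⟨i, hi, hwi⟩ := hcov ω hω
      have hle : (w i).length ≤ v.length := by
        have : (w i).length ≤ T.sup fun i => (w i).length :=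
          Finset.le_sup (f := fun i => (w i).length) hi
        omega
      obtain ⟨j, hj⟩ := Nat.exists_eq_add_of_le hle
      have hv' : v = w i ++ seqPrefix (seqShift (w i).length ω) j := by
        rw [← hpre, hj, seqPrefix_add, hwi]
      rw [Finset.mem_biUnion]
      refine ⟨i, hi, Finset.mem_image.2 ⟨_, ?_, hv'.symm⟩⟩
      rw [hv'] at hv
      rw [Finset.mem_filter, mem_wordsLE]
      refine ⟨⟨le_trans ?_ hv.1, hv.2.right⟩, hv.2⟩
      simp
  have h1 : ∑ v ∈ S.wordsLE n, f v ≤ ∑ v ∈ S.wordsLE L, f v +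
      ∑ i ∈ T, ∑ v ∈ S.wordsLE n, (K ^ 2) ^ s * (f (w i) * f v) := by
    refine (Finset.sum_le_sum_of_subset_of_nonneg hsub fun _ _ _ => hf0 _).trans ?_
    have hu : ∀ A B : Finset (List (Fin (2 * S.r))),
        ∑ v ∈ A ∪ B, f v ≤ ∑ v ∈ A, f v + ∑ v ∈ B, f v := by
      intro A B
      rw [← Finset.sum_union_inter]
      exact le_add_of_nonneg_right (Finset.sum_nonneg fun _ _ => hf0 _)
    refine (hu _ _).trans (add_le_add le_rfl ?_)
    have hbi : ∀ (T : Finset ℕ) (g : ℕ → Finset (List (Fin (2 * S.r)))),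
        ∑ v ∈ T.biUnion g, f v ≤ ∑ i ∈ T, ∑ v ∈ g i, f v := by
      intro T g
      induction T using Finset.induction_on with
      | empty => simp
      | insert i T hi ih =>
        rw [Finset.biUnion_insert, Finset.sum_insert hi]
        exact (hu _ _).trans (add_le_add le_rfl ih)
    refine (hbi _ _).trans (Finset.sum_le_sum fun i _ => ?_)
    rw [Finset.sum_image (fun _ _ _ _ h => List.append_cancel_left h)]
    refine (Finset.sum_le_sum fun v hv => hfmul _ _ (Finset.mem_filter.1 hv).2).trans ?_
    exact Finset.sum_le_sum_of_subset_of_nonneg (Finset.filter_subset _ _) fun v _ _ =>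
      mul_nonneg hKs.le (mul_nonneg (hf0 _) (hf0 _))
  have h2 : ∑ i ∈ T, ∑ v ∈ S.wordsLE n, (K ^ 2) ^ s * (f (w i) * f v) =
      ((K ^ 2) ^ s * ∑ i ∈ T, f (w i)) * ∑ v ∈ S.wordsLE n, f v := by
    rw [mul_assoc, Finset.sum_mul_sum, Finset.mul_sum]
    exact Finset.sum_congr rfl fun i _ => by rw [Finset.mul_sum]
  have h3 : (K ^ 2) ^ s * ∑ i ∈ T, f (w i) ≤ 1 / 2 := by
    calc _ ≤ (K ^ 2) ^ s * (((K ^ 2) ^ s)⁻¹ / 2) := by gcongr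
      _ = 1 / 2 := by field_simp
  have h4 : 0 ≤ ∑ v ∈ S.wordsLE n, f v := Finset.sum_nonneg fun _ _ => hf0 _
  rw [h2] at h1
  nlinarith

theorem exists_one_le_mul_size (S : Schottky) :
    ∃ K : ℝ, 1 ≤ K ∧ ∀ w, IsWord w → 1 ≤ K * S.size w := by
  obtain ⟨C, lam, -, hlam, h⟩ := S.exists_pow_le_size
  refine ⟨max 1 C, le_max_left _ _, fun w hw => ?_⟩
  have hpos := S.size_pos hw
  rcases le_total 1 (S.size w) with h1 | h1
  · exact one_le_mul_of_one_le_of_one_le (le_max_left _ _) h1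
  · calc (1 : ℝ) ≤ lam ^ w.length := one_le_pow₀ hlam.le
      _ ≤ C * S.size w ^ 2 := h w hw
      _ ≤ max 1 C * S.size w := by
        gcongr
        · exact le_max_right _ _
        · nlinarith

theorem exists_size_left_le (S : Schottky) :
    ∃ K : ℝ, 1 ≤ K ∧ ∀ u v, IsWord (u ++ v) → S.size u ≤ K * S.size (u ++ v) := by
  obtain ⟨K, hK, hmul⟩ := S.exists_size_mul
  obtain ⟨L, hL, hlow⟩ := S.exists_one_le_mul_size
  refine ⟨K * L, one_le_mul_of_one_le_of_one_le hK hL, fun u v h => ?_⟩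
  have hu := S.size_pos h.left
  calc S.size u ≤ S.size u * (L * S.size v) := le_mul_of_one_le_right hu.le (hlow v h.right)
    _ = L * (S.size u * S.size v) := by ring
    _ ≤ L * (K * S.size (u ++ v)) := mul_le_mul_of_nonneg_left (hmul u v h).2 (by positivity)
    _ = _ := by ring

theorem exists_size_cons_le (S : Schottky) :
    ∃ K : ℝ, 1 ≤ K ∧ ∀ x v, IsWord (x :: v) → S.size (x :: v) ≤ K * S.size v := by
  obtain ⟨K, hK, hmul⟩ := S.exists_size_mul
  have hsum : ∀ x, S.size [x] ≤ 1 + ∑ y, S.size [y] := fun x => by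
    have := Finset.single_le_sum (f := fun y => S.size [y])
      (fun y _ => (S.size_pos (isWord_singleton y)).le) (Finset.mem_univ x)
    linarith
  have hnn : 0 ≤ ∑ y, S.size [y] :=
    Finset.sum_nonneg fun y _ => (S.size_pos (isWord_singleton y)).le
  refine ⟨K * (1 + ∑ y, S.size [y]), one_le_mul_of_one_le_of_one_le hK (by linarith),
    fun x v h => ?_⟩
  have hw : IsWord ([x] ++ v) := h
  have hv := S.size_pos hw.right
  calc S.size (x :: v) ≤ K * (S.size [x] * S.size v) := (hmul [x] v hw).1
    _ ≤ K * ((1 + ∑ y, S.size [y]) * S.size v) := by gcongr; exact hsum x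
    _ = _ := by ring

theorem exists_size_Zbar_le (S : Schottky) :
    ∃ K : ℝ, 1 ≤ K ∧ ∀ τ, 0 < τ → τ ≤ 1 → ∀ a ∈ S.Zbar τ, S.size a ^ 2 ≤ K / τ := by
  obtain ⟨K, hK, hcons⟩ := S.exists_size_cons_le
  obtain ⟨U, hU, hups⟩ := S.exists_ups_bound
  refine ⟨K ^ 4 * U, one_le_mul_of_one_le_of_one_le (one_le_pow₀ hK) hU,
    fun τ hτ hτ1 a ha => ?_⟩
  obtain ⟨haw, -, hne, -, hlt⟩ := ha
  rw [le_div_iff₀ hτ]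
  match a, haw, hne, hlt with
  | [], _, hne, _ => simp at hne
  | [x], haw, _, _ =>
    have h1 : S.size [x] ≤ K := by simpa using hcons x [] haw
    have h0 := S.size_pos haw
    calc S.size [x] ^ 2 * τ ≤ K ^ 2 * 1 := by gcongr
      _ ≤ K ^ 4 * 1 := by gcongr; norm_num
      _ ≤ K ^ 4 * U := by gcongr
  | x :: y :: l, haw, _, hlt =>
    have hyl : IsWord (y :: l) := IsWord.right (u := [x]) haw
    have hl : IsWord l := IsWord.right (u := [y]) hyl
    have hm : IsWord (mirror l ++ [wordBar y]) := by simpa using hyl.mirror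
    have h1 := hcons _ _ haw
    have h2 := hcons _ _ hyl
    have h3 := (hups _ _ hm).1
    rw [size_mirror] at h3
    have hlt' : τ < S.ups (mirror l ++ [wordBar y]) := by
      simpa only [mirror_cons, List.dropLast_concat] using hlt
    have p0 := S.size_pos haw
    calc S.size (x :: y :: l) ^ 2 * τ ≤ (K * (K * S.size l)) ^ 2 * τ := by
          gcongr
          exact h1.trans (by gcongr)
      _ = K ^ 4 * (τ * S.size l ^ 2) := by ring
      _ ≤ K ^ 4 * (S.ups (mirror l ++ [wordBar y]) * S.size l ^ 2) := by gcongr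
      _ ≤ K ^ 4 * U := by gcongr

theorem exists_length_Zbar_le (S : Schottky) {η : ℝ} (hη : 0 < η) :
    ∃ L : ℝ, 0 < L ∧ ∀ τ, 0 < τ → τ ≤ 1 → ∀ a ∈ S.Zbar τ, (a.length : ℝ) ≤ L * τ ^ (-η) := by
  obtain ⟨C, lam, hC, hlam, hpow⟩ := S.exists_pow_le_size
  obtain ⟨K, hK, hsize⟩ := S.exists_size_Zbar_le
  have hlam0 : 0 < lam := one_pos.trans hlam
  have hgap : 0 < lam ^ η - 1 := sub_pos.2 (Real.one_lt_rpow hlam hη)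
  refine ⟨(C * K) ^ η / (lam ^ η - 1), by positivity, fun τ hτ hτ1 a ha => ?_⟩
  have h1 : lam ^ a.length ≤ C * K * τ⁻¹ := by
    calc lam ^ a.length ≤ C * S.size a ^ 2 := hpow a ha.1
      _ ≤ C * (K / τ) := by gcongr; exact hsize τ hτ hτ1 a ha
      _ = _ := by ring
  have h2 : 1 + (a.length : ℝ) * (lam ^ η - 1) ≤ (1 + (lam ^ η - 1)) ^ a.length :=
    one_add_mul_le_pow (by linarith) _
  have h3 : (1 + (lam ^ η - 1)) ^ a.length = (lam ^ a.length) ^ η := by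
    rw [add_sub_cancel, ← Real.rpow_natCast, ← Real.rpow_natCast, ← Real.rpow_mul hlam0.le,
      ← Real.rpow_mul hlam0.le, mul_comm]
  have h4 : (lam ^ a.length) ^ η ≤ (C * K) ^ η * τ ^ (-η) := by
    rw [Real.rpow_neg hτ.le, ← Real.inv_rpow hτ.le, ← Real.mul_rpow (by positivity) (by positivity)]
    exact Real.rpow_le_rpow (by positivity) h1 hη.le
  rw [div_mul_eq_mul_div, le_div_iff₀ hgap]
  linarith

/-- The pair of words recovered from the base `x = p ++ s` of the conjugated power
`p s^q p⁻¹`, the cut `i` between `p` and `s`, the cut `j` of the power into the two words,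
their common suffix `c` and their last letters. -/
def decodePair {r : ℕ} (x c : List (Fin (2 * r))) (i j q : ℕ) (e f : Fin (2 * r)) :
    List (Fin (2 * r)) × List (Fin (2 * r)) :=
  let w := x.take i ++ wordPow (x.drop i) q ++ mirror (x.take i)
  (w.take j ++ c ++ [e], mirror (w.drop j) ++ c ++ [f])

theorem exists_decodePair_eq (S : Schottky) :
    ∃ K : ℝ, 1 ≤ K ∧ ∀ τ, ∀ ab ∈ S.PowerPairs τ, ∃ x c i j q e f,
      ab = decodePair x c i j q e f ∧ IsWord x ∧ IsWord c ∧
      x.length ≤ ab.1.length + ab.2.length ∧ c.length ≤ ab.1.length + ab.2.length ∧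
      i ≤ ab.1.length + ab.2.length ∧ j ≤ ab.1.length + ab.2.length ∧
      q ≤ ab.1.length + ab.2.length ∧
      (S.size x * S.size c) ^ 2 ≤ K * (S.size ab.1 * S.size ab.2) := by
  obtain ⟨K, hK, hmul⟩ := S.exists_size_mul
  obtain ⟨L, hL, hleft⟩ := S.exists_size_left_le
  obtain ⟨M, hM, hlow⟩ := S.exists_one_le_mul_size
  refine ⟨K ^ 9 * M * L ^ 2, by
    refine one_le_mul_of_one_le_of_one_le (one_le_mul_of_one_le_of_one_le ?_ hM) ?_ <;>
      exact one_le_pow₀ (by assumption), ?_⟩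
  rintro τ ⟨a, b⟩ ⟨⟨ha, -, hane, -⟩, ⟨hb, -, hbne, -⟩, hne, γ, hγ, q, hq, heq⟩
  rw [Ne, mirror_eq_nil] at hane hbne
  obtain ⟨a, e, rfl⟩ := List.eq_nil_or_concat' a |>.resolve_left hane
  obtain ⟨b, f, rfl⟩ := List.eq_nil_or_concat' b |>.resolve_left hbne
  obtain ⟨u, v, c, rfl, rfl, huv⟩ := exists_common_suffix a b ha.left hb.left
  obtain ⟨y, hy, rfl⟩ := exists_word hγ
  obtain ⟨p, s, rfl, hss⟩ := exists_conj_cyclic y.length y le_rfl hy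
  simp only [List.dropLast_concat] at hne heq
  have hquot : S.wprod (u ++ c) * (S.wprod (v ++ c))⁻¹ = S.wprod (u ++ mirror v) := by
    simp only [wprod_append, wprod_mirror]
    group
  rw [hquot] at hne heq
  have hs : s ≠ [] := by
    rintro rfl
    apply hne
    rw [heq]
    simp
  obtain ⟨k, rfl⟩ := Nat.exists_eq_add_of_le' hq
  have hconj := isWord_conj_wordPow hs hy hss (k + 1)
  have hw : u ++ mirror v = p ++ wordPow s (k + 2) ++ mirror p := by
    refine wprod_injOn huv hconj ?_
    rw [heq]
    simp only [wprod_append, wprod_mirror, wprod_wordPow]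
    rw [conj_pow]
  have hlen := congrArg List.length hw
  simp only [List.length_append, length_mirror] at hlen
  have hq' := le_length_wordPow hs (k + 2)
  have hslen : s.length ≤ (wordPow s (k + 2)).length := by
    rw [wordPow_succ, List.length_append]
    exact Nat.le_add_right _ _
  have hps : IsWord (p ++ s) := hy.left
  refine ⟨p ++ s, c, p.length, u.length, k + 2, e, f, ?_, hps, ha.left.right, ?_, ?_, ?_, ?_, ?_,
    ?_⟩
  · simp only [decodePair, List.take_left', List.drop_left', ← hw, mirror_mirror]
  any_goals simp only [List.length_append]; omega
  rw [hw] at huv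
  set X := wordPow s k ++ mirror p with hX
  have hw1 : p ++ wordPow s (k + 2) ++ mirror p = p ++ (s ++ (s ++ X)) := by
    simp [wordPow_succ, hX]
  rw [hw1] at huv hw
  have w2 := huv.right
  have w3 := w2.right
  have w4 := w3.right
  have hp0 := S.size_pos huv.left
  have hs0 := S.size_pos w2.left
  have hX0 := S.size_pos w4
  have hu0 := S.size_pos ha.left.left
  have hv0 := S.size_pos hb.left.left
  have hc0 := S.size_pos ha.left.right
  have hps0 := S.size_pos hps
  have ha0 := S.size_pos ha
  have hb0 := S.size_pos hb
  have e1 := (hmul _ _ huv).2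
  have e2 := (hmul _ _ w2).2
  have e3 := (hmul _ _ w3).2
  have e4 := (hmul _ _ w4).2
  rw [size_mirror] at e4
  have e5 := hlow _ w4.left
  have e6 := (hmul _ _ hps).1
  have e7 := (hmul u (mirror v) (hw ▸ huv)).1
  rw [size_mirror, hw] at e7
  have e8 := (hmul _ _ ha.left).2.trans (mul_le_mul_of_nonneg_left (hleft _ _ ha) (by positivity))
  have e9 := (hmul _ _ hb.left).2.trans (mul_le_mul_of_nonneg_left (hleft _ _ hb) (by positivity))
  have hX1 : S.size p ≤ M * K * S.size X := by
    calc S.size p ≤ S.size p * (M * S.size (wordPow s k)) := le_mul_of_one_le_right hp0.le e5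
      _ = M * (S.size (wordPow s k) * S.size p) := by ring
      _ ≤ M * (K * S.size X) := by gcongr
      _ = _ := by ring
  have hpow : (S.size p * S.size s) ^ 2 ≤ M * K ^ 4 * S.size (p ++ (s ++ (s ++ X))) := by
    calc (S.size p * S.size s) ^ 2 = S.size p * (S.size s * (S.size s * S.size p)) := by ring
      _ ≤ S.size p * (S.size s * (S.size s * (M * K * S.size X))) := by gcongr
      _ = M * K * (S.size p * (S.size s * (S.size s * S.size X))) := by ring
      _ ≤ M * K * (S.size p * (S.size s * (K * S.size (s ++ X)))) := by gcongr
      _ = M * K ^ 2 * (S.size p * (S.size s * S.size (s ++ X))) := by ring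
      _ ≤ M * K ^ 2 * (S.size p * (K * S.size (s ++ (s ++ X)))) := by gcongr
      _ = M * K ^ 3 * (S.size p * S.size (s ++ (s ++ X))) := by ring
      _ ≤ M * K ^ 3 * (K * S.size (p ++ (s ++ (s ++ X)))) := by gcongr
      _ = _ := by ring
  calc (S.size (p ++ s) * S.size c) ^ 2 ≤ (K * (S.size p * S.size s) * S.size c) ^ 2 := by gcongr
    _ = K ^ 2 * S.size c ^ 2 * (S.size p * S.size s) ^ 2 := by ring
    _ ≤ K ^ 2 * S.size c ^ 2 * (M * K ^ 4 * (K * (S.size u * S.size v))) := by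
      gcongr
      exact hpow.trans (by gcongr)
    _ = M * K ^ 7 * ((S.size u * S.size c) * (S.size v * S.size c)) := by ring
    _ ≤ M * K ^ 7 * ((K * (L * S.size (u ++ c ++ [e]))) * (K * (L * S.size (v ++ c ++ [f])))) := by
      gcongr
    _ = K ^ 9 * M * L ^ 2 * (S.size (u ++ c ++ [e]) * S.size (v ++ c ++ [f])) := by ring

theorem card_pairs_le {s B R : ℝ} (hs : 0 < s) (hR : 0 < R) (n : ℕ)
    (hB : ∑ w ∈ S.wordsLE n, ((S.size w ^ 2)⁻¹) ^ s ≤ B)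
    (F : Finset (List (Fin (2 * S.r)) × List (Fin (2 * S.r))))
    (hF : F ⊆ S.wordsLE n ×ˢ S.wordsLE n)
    (hFR : ∀ z ∈ F, (S.size z.1 * S.size z.2) ^ 2 ≤ R) :
    (F.card : ℝ) ≤ B ^ 2 * R ^ s := by
  have hterm : ∀ z ∈ F, (R ^ s)⁻¹ ≤ ((S.size z.1 ^ 2)⁻¹) ^ s * ((S.size z.2 ^ 2)⁻¹) ^ s := by
    intro z hz
    have hz' := Finset.mem_product.1 (hF hz)
    have h1 := S.size_pos (mem_wordsLE.1 hz'.1).2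
    have h2 := S.size_pos (mem_wordsLE.1 hz'.2).2
    rw [← Real.mul_rpow (by positivity) (by positivity), ← Real.inv_rpow hR.le, ← mul_inv,
      ← mul_pow]
    refine Real.rpow_le_rpow (by positivity) ?_ hs.le
    gcongr
    exact hFR z hz
  have hnn : 0 ≤ ∑ w ∈ S.wordsLE n, ((S.size w ^ 2)⁻¹) ^ s :=
    Finset.sum_nonneg fun _ _ => by positivity
  have hsum : (F.card : ℝ) * (R ^ s)⁻¹ ≤ B ^ 2 := by
    calc (F.card : ℝ) * (R ^ s)⁻¹ = ∑ z ∈ F, (R ^ s)⁻¹ := by simp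
      _ ≤ ∑ z ∈ F, ((S.size z.1 ^ 2)⁻¹) ^ s * ((S.size z.2 ^ 2)⁻¹) ^ s := Finset.sum_le_sum hterm
      _ ≤ ∑ z ∈ S.wordsLE n ×ˢ S.wordsLE n,
          ((S.size z.1 ^ 2)⁻¹) ^ s * ((S.size z.2 ^ 2)⁻¹) ^ s :=
        Finset.sum_le_sum_of_subset_of_nonneg hF fun _ _ _ => by positivity
      _ = (∑ w ∈ S.wordsLE n, ((S.size w ^ 2)⁻¹) ^ s) ^ 2 := by
        rw [Finset.sum_product, sq, Finset.sum_mul_sum]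
      _ ≤ B ^ 2 := by gcongr
  rwa [← div_eq_mul_inv, div_le_iff₀ (by positivity)] at hsum

theorem exists_ncard_powerPairs_le (S : Schottky) {ε : ℝ} (hε : 0 < ε) :
    ∃ C : ℝ, 0 < C ∧ ∀ τ, 0 < τ → τ ≤ 1 →
      ((S.PowerPairs τ).ncard : ℝ) ≤ C * τ ^ (-(S.delta + ε)) := by
  classical
  have hδ := S.delta_nonneg
  set s := S.delta + ε / 2 with hs
  have hs0 : 0 < s := by linarith
  obtain ⟨B, hB⟩ := S.exists_poincare_bound (show S.delta < s by linarith)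
  obtain ⟨L, hL, hlen⟩ := S.exists_length_Zbar_le (η := ε / 6) (by linarith)
  obtain ⟨Z, hZ, hsize⟩ := S.exists_size_Zbar_le
  obtain ⟨K, hK, hdec⟩ := S.exists_decodePair_eq
  have hr : (0 : ℝ) < 2 * S.r := by
    have := S.two_le_r
    positivity
  refine ⟨(B ^ 2 + 1) * (K * Z) ^ s * (2 * L + 1) ^ 3 * (2 * S.r) ^ 2, by positivity,
    fun τ hτ hτ1 => ?_⟩
  set N := ⌊2 * L * τ ^ (-(ε / 6))⌋₊ with hN
  have hτη : 1 ≤ τ ^ (-(ε / 6)) :=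
    Real.one_le_rpow_of_pos_of_le_one_of_nonpos hτ hτ1 (by linarith)
  have hN1 : (N : ℝ) + 1 ≤ (2 * L + 1) * τ ^ (-(ε / 6)) := by
    have := Nat.floor_le (a := 2 * L * τ ^ (-(ε / 6))) (by positivity)
    linarith
  have hR : 0 < K * Z / τ := by positivity
  set F := {z ∈ S.wordsLE N ×ˢ S.wordsLE N | (S.size z.1 * S.size z.2) ^ 2 ≤ K * Z / τ} with hF
  have hFcard := card_pairs_le hs0 hR N (hB N) F (Finset.filter_subset _ _)
    fun z hz => (Finset.mem_filter.1 hz).2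
  set G := (F ×ˢ Finset.range (N + 1) ×ˢ Finset.range (N + 1) ×ˢ Finset.range (N + 1) ×ˢ
    (Finset.univ : Finset (Fin (2 * S.r) × Fin (2 * S.r)))) with hG
  have hsub : S.PowerPairs τ ⊆ (G.image fun t =>
      decodePair t.1.1 t.1.2 t.2.1 t.2.2.1 t.2.2.2.1 t.2.2.2.2.1 t.2.2.2.2.2 :
        Set (List (Fin (2 * S.r)) × List (Fin (2 * S.r)))) := by
    intro ab hab
    have hlab : ab.1.length + ab.2.length ≤ N := by
      rw [hN, Nat.le_floor_iff (by positivity)]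
      push_cast
      linarith [hlen τ hτ hτ1 _ hab.1, hlen τ hτ hτ1 _ hab.2.1]
    have hsab : S.size ab.1 * S.size ab.2 ≤ Z / τ := by
      nlinarith [hsize τ hτ hτ1 _ hab.1, hsize τ hτ hτ1 _ hab.2.1,
        sq_nonneg (S.size ab.1 - S.size ab.2)]
    obtain ⟨x, c, i, j, q, e, f, rfl, hx, hc, hxl, hcl, hi, hj, hq, hxc⟩ := hdec τ ab hab
    rw [Finset.mem_coe, Finset.mem_image]
    refine ⟨((x, c), i, j, q, e, f), ?_, rfl⟩
    simp only [hG, hF, Finset.mem_product, Finset.mem_filter, mem_wordsLE, Finset.mem_range,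
      Finset.mem_univ, and_true]
    refine ⟨⟨⟨⟨by omega, hx⟩, by omega, hc⟩, hxc.trans ?_⟩, by omega, by omega, by omega⟩
    rw [mul_div_assoc]
    gcongr
  have hcard : ((S.PowerPairs τ).ncard : ℝ) ≤ G.card := by
    have h1 := Set.ncard_le_ncard hsub (Finset.finite_toSet _)
    rw [Set.ncard_coe_finset] at h1
    exact_mod_cast h1.trans Finset.card_image_le
  have hGcard : (G.card : ℝ) = F.card * ((N : ℝ) + 1) ^ 3 * (2 * S.r) ^ 2 := by
    simp only [hG, Finset.card_product, Finset.card_range, Finset.card_univ, Fintype.card_prod,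
      Fintype.card_fin]
    push_cast
    ring
  have hpow : (K * Z / τ) ^ s * (τ ^ (-(ε / 6))) ^ 3 = (K * Z) ^ s * τ ^ (-(S.delta + ε)) := by
    rw [Real.div_rpow (by positivity) hτ.le, div_eq_mul_inv, ← Real.rpow_neg hτ.le, mul_assoc,
      ← Real.rpow_natCast, ← Real.rpow_mul hτ.le, ← Real.rpow_add hτ]
    congr 2
    rw [hs]
    push_cast
    ring
  calc ((S.PowerPairs τ).ncard : ℝ) ≤ F.card * ((N : ℝ) + 1) ^ 3 * (2 * S.r) ^ 2 :=
        hcard.trans hGcard.le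
    _ ≤ (B ^ 2 * (K * Z / τ) ^ s) * ((2 * L + 1) * τ ^ (-(ε / 6))) ^ 3 * (2 * S.r) ^ 2 := by
      gcongr
    _ = B ^ 2 * (2 * L + 1) ^ 3 * (2 * S.r) ^ 2 * ((K * Z / τ) ^ s * (τ ^ (-(ε / 6))) ^ 3) := by
      ring
    _ = B ^ 2 * (K * Z) ^ s * (2 * L + 1) ^ 3 * (2 * S.r) ^ 2 * τ ^ (-(S.delta + ε)) := by
      rw [hpow]
      ring
    _ ≤ _ := by
      gcongr
      linarith

end Schottky

/-- for every `ε > 0` there is `τ₂ > 0` such that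
`#PowerPairs(τ) ≤ τ^{−δ−ε}` for all `τ ∈ (0, τ₂]`. -/
theorem stmt_9 (S : Schottky) :
    ∀ ε : ℝ, 0 < ε →
      ∃ τ₂ : ℝ, 0 < τ₂ ∧
        ∀ τ : ℝ, 0 < τ → τ ≤ τ₂ →
          ((S.PowerPairs τ).ncard : ℝ) ≤ τ ^ (-(S.delta + ε)) := by
  intro ε hε
  obtain ⟨C, hC, hcount⟩ := S.exists_ncard_powerPairs_le (half_pos hε)
  refine ⟨min 1 (C⁻¹ ^ (ε / 2)⁻¹), by positivity, fun τ hτ hτ₂ => ?_⟩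
  obtain ⟨hτ1, hτC⟩ := le_min_iff.1 hτ₂
  have hbound : C ≤ τ ^ (-(ε / 2)) := by
    rw [Real.rpow_neg hτ.le, le_inv_comm₀ hC (by positivity)]
    calc τ ^ (ε / 2) ≤ (C⁻¹ ^ (ε / 2)⁻¹) ^ (ε / 2) :=
          Real.rpow_le_rpow hτ.le hτC (half_pos hε).le
      _ = C⁻¹ := Real.rpow_inv_rpow (by positivity) (half_pos hε).ne'
  calc ((S.PowerPairs τ).ncard : ℝ) ≤ C * τ ^ (-(S.delta + ε / 2)) := hcount τ hτ hτ1
    _ ≤ τ ^ (-(ε / 2)) * τ ^ (-(S.delta + ε / 2)) := by gcongr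
    _ = τ ^ (-(S.delta + ε)) := by
      rw [← Real.rpow_add hτ]
      congr 1
      ring
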